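/- arXiv:2103.07273 — 2 statements merged into one kernel-verified Lean document; each statement's English description precedes it below -/
import Mathlib

section
/- Under the standing assumptions, the spherical average at the origin has zero boundary values in the L² sense: the map r ↦ E[(h_r(0))²] is nonincreasing on r ∈ (0, 1) near 1 and E[(h_r(0))²] decreases to 0 as r ↑ 1. -/
open MeasureTheory ProbabilityTheory Metric Filter Topology Set

noncomputable section

abbrev Euc (d : ℕ) : Type := EuclideanSpace ℝ (Fin d)

/-- The scaling function `s`: `s(r) = -log r` if `d = 2`, and `s(r) = r^(2-d)` if `d ≥ 3`. -/
noncomputable def sFun (d : ℕ) (r : ℝ) : ℝ :=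
  if d = 2 then -Real.log r else r ^ ((2 : ℝ) - (d : ℝ))

open Classical in
/-- The zero boundary Green's function of the open unit ball in `ℝ^d`:
`G(x,y) = s(|x-y|) - s(|x|·|y - x/|x|²|)`, interpreted by continuity at `x = 0`. -/
noncomputable def greenBall (d : ℕ) (x y : Euc d) : ℝ :=
  if x = 0 then sFun d ‖y‖ - sFun d 1
  else sFun d ‖x - y‖ - sFun d (‖x‖ * ‖y - (‖x‖ ^ 2)⁻¹ • x‖)

/-- Smooth compactly supported test functions. -/
def IsTestFun {d : ℕ} (f : Euc d → ℝ) : Prop :=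
  ContDiff ℝ (⊤ : ℕ∞) f ∧ HasCompactSupport f

/-- The Laplacian of `u : ℝ^d → ℝ` at `x`, as the sum of pure second derivatives in the
coordinate directions. -/
noncomputable def lap {d : ℕ} (u : Euc d → ℝ) (x : Euc d) : ℝ :=
  ∑ i : Fin d, iteratedFDeriv ℝ 2 u x ![EuclideanSpace.single i 1, EuclideanSpace.single i 1]

/-- A function is harmonic on a set if it is twice continuously differentiable there with
vanishing Laplacian. -/
def IsHarmonicOn {d : ℕ} (u : Euc d → ℝ) (s : Set (Euc d)) : Prop :=
  ContDiffOn ℝ 2 u s ∧ ∀ x ∈ s, lap u x = 0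

/-- A real random variable is a (possibly degenerate) centered Gaussian. -/
def IsCenteredGaussianRV {Ω : Type} [MeasurableSpace Ω] (P : Measure Ω) (Y : Ω → ℝ) : Prop :=
  ∃ v : NNReal, Measure.map Y P = ProbabilityTheory.gaussianReal 0 v

/-- The standing assumptions: a collection of stochastic processes `h a r` (thought of as
`h^{a + r𝔹}`) indexed by test functions, which is centered, a.s. linear, zero outside the ball,
translation/scaling covariant, satisfies the domain Markov property (with the decomposition
recorded as data `H`, `Φ`, `φharm`), has fourth moments, a (sequentially) continuous covariance
bilinear form on `C_c^∞(𝔹)`, and zero boundary conditions. -/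
structure GFF (d : ℕ) (Ω : Type) [MeasurableSpace Ω] where
  P : Measure Ω
  prob : IsProbabilityMeasure P
  /-- the field `h^{a+r𝔹}` tested against `f` -/
  h : Euc d → ℝ → (Euc d → ℝ) → Ω → ℝ
  meas_h : ∀ a r f, Measurable (h a r f)
  integrable_h : ∀ a r f, IsTestFun f → Integrable (h a r f) P
  /-- centered -/
  centered : ∀ a r f, IsTestFun f → ∫ ω, h a r f ω ∂P = 0
  /-- (1) a.s. linearity in the test function -/
  lin_add : ∀ f g : Euc d → ℝ, IsTestFun f → IsTestFun g →
    ∀ᵐ ω ∂P, h 0 1 (f + g) ω = h 0 1 f ω + h 0 1 g ω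
  lin_smul : ∀ (c : ℝ) (f : Euc d → ℝ), IsTestFun f →
    ∀ᵐ ω ∂P, h 0 1 (c • f) ω = c * h 0 1 f ω
  /-- (2) the field vanishes on test functions supported outside the ball -/
  zero_outside : ∀ f : Euc d → ℝ, IsTestFun f → tsupport f ⊆ (ball (0 : Euc d) 1)ᶜ →
    ∀ᵐ ω ∂P, h 0 1 f ω = 0
  /-- (3) translation and scaling: `(h^{a+r𝔹}, f((·-a)/r)) = r^{1+d/2} (h^𝔹, f)` in law,
  as processes (equality of finite dimensional distributions) -/
  scaling : ∀ (a : Euc d) (r : ℝ), 0 < r → ∀ (k : ℕ) (f : Fin k → Euc d → ℝ),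
    (∀ i, IsTestFun (f i)) →
    Measure.map (fun ω (i : Fin k) => h a r (fun x => f i (r⁻¹ • (x - a))) ω) P
      = Measure.map (fun ω (i : Fin k) => r ^ (1 + (d : ℝ) / 2) * h 0 1 (f i) ω) P
  /-- (4) domain Markov property: the decomposition data. `H a r` is the independent copy of
  `h^{a+r𝔹}`, `Φ a r` is the harmonic part as a process, `φharm a r ω` is the harmonic function. -/
  H : Euc d → ℝ → (Euc d → ℝ) → Ω → ℝ
  Φ : Euc d → ℝ → (Euc d → ℝ) → Ω → ℝ
  φharm : Euc d → ℝ → Ω → Euc d → ℝ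
  meas_H : ∀ a r f, Measurable (H a r f)
  meas_Φ : ∀ a r f, Measurable (Φ a r f)
  meas_φharm : ∀ a r z, Measurable fun ω => φharm a r ω z
  dmp_decomp : ∀ (a : Euc d) (r : ℝ), 0 < r → ball a r ⊆ ball (0 : Euc d) 1 →
    ∀ f : Euc d → ℝ, IsTestFun f → ∀ᵐ ω ∂P, h 0 1 f ω = H a r f ω + Φ a r f ω
  dmp_indep : ∀ (a : Euc d) (r : ℝ), 0 < r → ball a r ⊆ ball (0 : Euc d) 1 →
    ProbabilityTheory.Indep
      (⨆ f : {f : Euc d → ℝ // IsTestFun f}, MeasurableSpace.comap (H a r f.1) inferInstance)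
      ((⨆ f : {f : Euc d → ℝ // IsTestFun f}, MeasurableSpace.comap (Φ a r f.1) inferInstance) ⊔
        (⨆ z : Euc d, MeasurableSpace.comap (fun ω => φharm a r ω z) inferInstance)) P
  dmp_law : ∀ (a : Euc d) (r : ℝ), 0 < r → ball a r ⊆ ball (0 : Euc d) 1 →
    ∀ (k : ℕ) (f : Fin k → Euc d → ℝ), (∀ i, IsTestFun (f i)) →
    Measure.map (fun ω (i : Fin k) => H a r (f i) ω) P
      = Measure.map (fun ω (i : Fin k) => h a r (f i) ω) P
  dmp_harm : ∀ (a : Euc d) (r : ℝ), 0 < r → ball a r ⊆ ball (0 : Euc d) 1 →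
    ∀ᵐ ω ∂P, IsHarmonicOn (φharm a r ω) (ball a r) ∧
      ∀ f : Euc d → ℝ, IsTestFun f → tsupport f ⊆ ball a r →
        Φ a r f ω = ∫ x in ball a r, φharm a r ω x * f x
  /-- (5) fourth moments -/
  mom4 : ∀ f : Euc d → ℝ, IsTestFun f → Integrable (fun ω => (h 0 1 f ω) ^ 4) P
  /-- (6) sequential continuity of the covariance bilinear form on `C_c^∞(𝔹)` -/
  K2_cont : ∀ (f : ℕ → Euc d → ℝ) (f₀ g : Euc d → ℝ) (K : Set (Euc d)),
    IsCompact K → K ⊆ ball (0 : Euc d) 1 →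
    (∀ n, IsTestFun (f n)) → IsTestFun f₀ → IsTestFun g → tsupport g ⊆ ball (0 : Euc d) 1 →
    (∀ n, tsupport (f n) ⊆ K) → tsupport f₀ ⊆ K →
    (∀ m : ℕ, TendstoUniformly (fun n => iteratedFDeriv ℝ m (f n)) (iteratedFDeriv ℝ m f₀) atTop) →
    Tendsto (fun n => ∫ ω, h 0 1 (f n) ω * h 0 1 g ω ∂P) atTop
      (𝓝 (∫ ω, h 0 1 f₀ ω * h 0 1 g ω ∂P))
  /-- (7) zero boundary conditions -/
  zero_bdry : ∀ f : ℕ → Euc d → ℝ,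
    (∀ n, IsTestFun (f n)) → (∀ n x, 0 ≤ f n x) →
    (∃ C : ℝ, ∀ n, ∫ x, f n x ≤ C) →
    Tendsto (fun n => Metric.infDist (0 : Euc d) (tsupport (f n))) atTop (𝓝 1) →
    (∃ C : ℝ, ∀ (n : ℕ) (x y : Euc d), ‖x‖ = ‖y‖ → ‖x‖ < 1 → f n x ≤ C * f n y) →
    Tendsto (fun n => ∫ ω, (h 0 1 (f n) ω) ^ 2 ∂P) atTop (𝓝 0)

instance {d : ℕ} {Ω : Type} [MeasurableSpace Ω] (X : GFF d Ω) : IsProbabilityMeasure X.P :=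
  X.prob

/-- The spherical average `h_ε(z) = φ^{z+ε𝔹}_𝔹(z)`. -/
noncomputable def GFF.sphAvg {d : ℕ} {Ω : Type} [MeasurableSpace Ω] (X : GFF d Ω) (z : Euc d) (ε : ℝ) (ω : Ω) : ℝ :=
  X.φharm z ε ω z

/-- A function vanishing beyond distance `ρ` from the origin has compact support. -/
lemma hasCompactSupport_of_norm_ge {d : ℕ} {f : Euc d → ℝ} {ρ : ℝ}
    (hf : ∀ x, ρ ≤ ‖x‖ → f x = 0) : HasCompactSupport f :=
  HasCompactSupport.intro (isCompact_closedBall (0 : Euc d) ρ) fun x hx =>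
    hf x (by simpa using (not_le.1 (by simpa using hx)).le)

lemma sq_le_norm_sq {d : ℕ} {x : Euc d} {ρ : ℝ} (hρ : 0 ≤ ρ) (hx : ρ ≤ ‖x‖) :
    ρ ^ 2 ≤ ‖x‖ ^ 2 := by gcongr

/-- A `C¹` radial primitive: `x ↦ g (‖x‖²) x` is the gradient of a compactly supported function. -/
lemma exists_radial_primitive {d : ℕ} {g : ℝ → ℝ} (hg : Continuous g) {ρ : ℝ} (hρ : 0 ≤ ρ)
    (hgρ : ∀ s, ρ ^ 2 ≤ s → g s = 0) :
    ∃ F : Euc d → ℝ, (∀ x, HasFDerivAt F (g (‖x‖ ^ 2) • innerSL ℝ x) x) ∧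
      ∀ x, ρ ≤ ‖x‖ → F x = 0 := by
  refine ⟨fun x => ∫ s in (ρ ^ 2)..(‖x‖ ^ 2), g s / 2, fun x => ?_, fun x hx => ?_⟩
  · have h1 : HasDerivAt (fun t : ℝ => ∫ s in (ρ ^ 2)..t, g s / 2) (g (‖x‖ ^ 2) / 2) (‖x‖ ^ 2) :=
      (hg.div_const 2).integral_hasStrictDerivAt _ _ |>.hasDerivAt
    have h2 := (hasStrictFDerivAt_norm_sq x).hasFDerivAt
    refine (h1.comp_hasFDerivAt x h2).congr_fderiv ?_
    ext v
    simp
    ring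
  · have hx' := sq_le_norm_sq hρ hx
    refine (intervalIntegral.integral_congr (g := fun _ => (0 : ℝ)) fun s hs => ?_).trans (by simp)
    rw [uIcc_of_le hx'] at hs
    simp [hgρ s hs.1]

/-- The integral of the derivative of a dilated function against a radial field vanishes where the
function is harmonic. -/
lemma integral_fderiv_radial_eq_zero {d : ℕ} {v : Euc d → ℝ} (hv : ContDiff ℝ 2 v) {g : ℝ → ℝ}
    (hg : Continuous g) {ρ : ℝ} (hρ : 0 ≤ ρ) (hgρ : ∀ s, ρ ^ 2 ≤ s → g s = 0)
    (hlap : ∀ x, ‖x‖ ≤ ρ → lap v x = 0) {t : ℝ} (ht0 : 0 ≤ t) (ht1 : t ≤ 1) :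
    ∫ x : Euc d, fderiv ℝ v (t • x) x * g (‖x‖ ^ 2) = 0 := by
  obtain ⟨F, hF, hFρ⟩ := exists_radial_primitive (d := d) hg hρ hgρ
  have hFc : Continuous F := continuous_iff_continuousAt.2 fun x => (hF x).continuousAt
  have hgc : Continuous fun x : Euc d => g (‖x‖ ^ 2) := hg.comp (by fun_prop)
  have hdv : ContDiff ℝ 1 (fderiv ℝ v) := hv.fderiv_right (by norm_num)
  let e : Fin d → Euc d := fun i => EuclideanSpace.single i 1
  let w : Fin d → Euc d → ℝ := fun i x => fderiv ℝ v (t • x) (e i)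
  have hw : ∀ i x, HasFDerivAt (w i)
      (t • (fderiv ℝ (fderiv ℝ v) (t • x)).flip (e i)) x := by
    intro i x
    have h1 : HasFDerivAt (fun y : Euc d => t • y) (t • ContinuousLinearMap.id ℝ (Euc d)) x :=
      (hasFDerivAt_id x).const_smul t
    have h2 := ((hdv.differentiable (by norm_num) (t • x)).hasFDerivAt.comp x h1).clm_apply
      (hasFDerivAt_const (e i) x)
    refine h2.congr_fderiv ?_
    ext y
    simp
  have hwc : ∀ i, Continuous (w i) := fun i =>
    continuous_iff_continuousAt.2 fun x => (hw i x).continuousAt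
  have hddc : Continuous fun x : Euc d => fderiv ℝ (fderiv ℝ v) (t • x) :=
    (hdv.continuous_fderiv (by norm_num)).comp (by fun_prop)
  have hsupp : ∀ {f : Euc d → ℝ}, Continuous f → (∀ x, ρ ≤ ‖x‖ → f x = 0) → Integrable f :=
    fun hf h => hf.integrable_of_hasCompactSupport (hasCompactSupport_of_norm_ge h)
  have hDF : ∀ i x, fderiv ℝ F x (e i) = g (‖x‖ ^ 2) * x i := by
    intro i x
    simp [(hF x).fderiv, e, EuclideanSpace.inner_single_right]
  have hDw : ∀ i x, fderiv ℝ (w i) x (e i) =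
      t * fderiv ℝ (fderiv ℝ v) (t • x) (e i) (e i) := by
    intro i x
    simp [(hw i x).fderiv]
  have hint1 : ∀ i, Integrable fun x => w i x * fderiv ℝ F x (e i) := by
    intro i
    simp only [hDF]
    refine hsupp ((hwc i).mul (hgc.mul (by fun_prop))) fun x hx => ?_
    simp [hgρ _ (sq_le_norm_sq hρ hx)]
  have hint2 : ∀ i, Integrable fun x => fderiv ℝ (w i) x (e i) * F x := by
    intro i
    simp only [hDw]
    refine hsupp (Continuous.mul (by fun_prop) hFc) fun x hx => ?_
    simp [hFρ x hx]
  have hibp : ∀ i, ∫ x, w i x * fderiv ℝ F x (e i) = -∫ x, fderiv ℝ (w i) x (e i) * F x := by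
    intro i
    refine integral_mul_fderiv_eq_neg_fderiv_mul_of_integrable (hint2 i) (hint1 i)
      (hsupp ((hwc i).mul hFc) fun x hx => by simp [hFρ x hx])
      (fun x _ => (hw i x).differentiableAt) (fun x _ => (hF x).differentiableAt)
  have hsum : ∀ x : Euc d, fderiv ℝ v (t • x) x * g (‖x‖ ^ 2) =
      ∑ i, w i x * fderiv ℝ F x (e i) := by
    intro x
    have hx : x = ∑ i, x i • e i := by
      ext j
      simp [e, Pi.single_apply]
    conv_lhs => rw [show fderiv ℝ v (t • x) x = ∑ i, x i * w i x by
      conv_lhs => arg 2; rw [hx]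
      simp [w]]
    rw [Finset.sum_mul]
    refine Finset.sum_congr rfl fun i _ => ?_
    rw [hDF]
    ring
  calc ∫ x : Euc d, fderiv ℝ v (t • x) x * g (‖x‖ ^ 2)
      = ∑ i, ∫ x, w i x * fderiv ℝ F x (e i) := by
        simp_rw [hsum]
        exact integral_finsetSum _ fun i _ => hint1 i
    _ = -∫ x, ∑ i, fderiv ℝ (w i) x (e i) * F x := by
        rw [integral_finsetSum _ fun i _ => hint2 i, ← Finset.sum_neg_distrib]
        exact Finset.sum_congr rfl fun i _ => hibp i
    _ = -∫ x : Euc d, (0 : ℝ) := by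
        congr 2
        ext x
        rw [← Finset.sum_mul]
        rcases le_or_gt ρ ‖x‖ with h | h
        · simp [hFρ x h]
        · have h1 : ‖t • x‖ ≤ ρ := by
            rw [norm_smul, Real.norm_of_nonneg ht0]
            exact (mul_le_of_le_one_left (norm_nonneg _) ht1).trans h.le
          have h2 := hlap _ h1
          simp only [lap, iteratedFDeriv_two_apply] at h2
          simp only [hDw, ← Finset.mul_sum]
          simp only [Matrix.cons_val_zero, Matrix.cons_val_one] at h2
          simp [e, h2]
    _ = 0 := by simp

/-- Mean value property against radial weights, for compactly supported `C²` functions that are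
harmonic on the support of the weight. -/
lemma integral_mul_radial_of_hasCompactSupport {d : ℕ} {v : Euc d → ℝ} (hv : ContDiff ℝ 2 v)
    (hvc : HasCompactSupport v) {g : ℝ → ℝ} (hg : Continuous g) {ρ : ℝ} (hρ : 0 ≤ ρ)
    (hgρ : ∀ s, ρ ^ 2 ≤ s → g s = 0) (hlap : ∀ x, ‖x‖ ≤ ρ → lap v x = 0) :
    ∫ x : Euc d, v x * g (‖x‖ ^ 2) = v 0 * ∫ x : Euc d, g (‖x‖ ^ 2) := by
  have hgc : Continuous fun x : Euc d => g (‖x‖ ^ 2) := hg.comp (by fun_prop)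
  have hdc : Continuous (fderiv ℝ v) := hv.continuous_fderiv (by norm_num)
  have hvcont : Continuous v := hv.continuous
  obtain ⟨C, hC⟩ := (hvc.fderiv (𝕜 := ℝ)).exists_bound_of_continuous hdc
  have hsupp : ∀ {f : Euc d → ℝ}, Continuous f → (∀ x, ρ ≤ ‖x‖ → f x = 0) → Integrable f :=
    fun hf h => hf.integrable_of_hasCompactSupport (hasCompactSupport_of_norm_ge h)
  have hg0 : ∀ x : Euc d, ρ ≤ ‖x‖ → g (‖x‖ ^ 2) = 0 := fun x hx => hgρ _ (sq_le_norm_sq hρ hx)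
  let M : ℝ → ℝ := fun t => ∫ x : Euc d, v (t • x) * g (‖x‖ ^ 2)
  have hM : ∀ t, HasDerivAt M (∫ x : Euc d, fderiv ℝ v (t • x) x * g (‖x‖ ^ 2)) t := by
    intro t
    refine (hasDerivAt_integral_of_dominated_loc_of_deriv_le (μ := volume) (s := univ)
      (F := fun t (x : Euc d) => v (t • x) * g (‖x‖ ^ 2))
      (F' := fun t (x : Euc d) => fderiv ℝ v (t • x) x * g (‖x‖ ^ 2))
      (bound := fun x : Euc d => C * ‖x‖ * ‖g (‖x‖ ^ 2)‖) univ_mem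
      (Eventually.of_forall fun s => Continuous.aestronglyMeasurable (by fun_prop))
      (hsupp (by fun_prop) fun x hx => by simp [hg0 x hx])
      (Continuous.aestronglyMeasurable ?_) ?_
      (hsupp (by fun_prop) fun x hx => by simp [hg0 x hx]) ?_).2
    · exact ((hdc.comp (by fun_prop : Continuous fun x : Euc d => t • x)).clm_apply
        continuous_id).mul hgc
    · refine Eventually.of_forall fun x s _ => ?_
      rw [norm_mul]
      gcongr
      exact (ContinuousLinearMap.le_opNorm _ _).trans (by gcongr; exact hC _)
    · refine Eventually.of_forall fun x s _ => HasDerivAt.mul_const ?_ _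
      have h1 : HasDerivAt (fun s : ℝ => s • x) x s := by
        simpa using (hasDerivAt_id s).smul_const x
      exact (hv.differentiable (by norm_num) (s • x)).hasFDerivAt.comp_hasDerivAt s h1
  have hconst : M 1 = M 0 := by
    refine constant_of_has_deriv_right_zero (a := 0) (b := 1)
      (fun t _ => (hM t).continuousAt.continuousWithinAt) (fun t ht => ?_) 1 (by simp)
    have := (hM t).hasDerivWithinAt (s := Ici t)
    rwa [integral_fderiv_radial_eq_zero hv hg hρ hgρ hlap ht.1 ht.2.le] at this
  simpa [M, integral_const_mul] using hconst

/-- Mean value property for harmonic functions on a ball, against radial weights. -/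
lemma IsHarmonicOn.setIntegral_mul_radial {d : ℕ} {u : Euc d → ℝ} {R : ℝ}
    (hu : IsHarmonicOn u (ball 0 R)) {g : ℝ → ℝ} (hg : Continuous g) {ρ : ℝ} (hρ : 0 ≤ ρ)
    (hρR : ρ < R) (hgρ : ∀ s, ρ ^ 2 ≤ s → g s = 0) :
    ∫ x in ball (0 : Euc d) R, u x * g (‖x‖ ^ 2) = u 0 * ∫ x : Euc d, g (‖x‖ ^ 2) := by
  obtain ⟨a, ha, haR⟩ := exists_between hρR
  obtain ⟨b, hb, hbR⟩ := exists_between haR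
  let χ : ContDiffBump (0 : Euc d) := ⟨a, b, by linarith, hb⟩
  let v : Euc d → ℝ := fun x => χ x * u x
  have hvu : ∀ x : Euc d, ‖x‖ < a → v =ᶠ[𝓝 x] u := by
    intro x hx
    filter_upwards [χ.eventuallyEq_one_of_mem_ball (x := x) (by simpa [χ] using hx)] with y hy
    simp [v, hy]
  have hvb : ∀ x : Euc d, b ≤ ‖x‖ → v x = 0 := by
    intro x hx
    simp [v, χ.zero_of_le_dist (x := x) (by simpa [χ] using hx)]
  have hv : ContDiff ℝ 2 v := by
    refine contDiff_iff_contDiffAt.2 fun x => ?_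
    rcases lt_or_ge ‖x‖ R with hx | hx
    · exact χ.contDiffAt.mul (hu.1.contDiffAt (isOpen_ball.mem_nhds (by simpa using hx)))
    · refine (contDiffAt_const (c := (0 : ℝ))).congr_of_eventuallyEq ?_
      filter_upwards [continuous_norm.continuousAt.eventually_mem
        (lt_mem_nhds (hbR.trans_le hx))] with y hy
      exact hvb y (le_of_lt hy)
  have key := integral_mul_radial_of_hasCompactSupport hv (hasCompactSupport_of_norm_ge hvb)
    hg hρ hgρ fun x hx => by
      have h := (hvu x (hx.trans_lt ha)).iteratedFDeriv (𝕜 := ℝ) 2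
      rw [lap, h.eq_of_nhds]
      exact hu.2 x (by simpa using hx.trans_lt hρR)
  rw [(hvu 0 (by simpa using hρ.trans_lt ha)).eq_of_nhds] at key
  rw [← key, ← integral_indicator measurableSet_ball]
  refine integral_congr_ae (Eventually.of_forall fun x => ?_)
  rcases lt_or_ge ‖x‖ ρ with hx | hx
  · simp [indicator, hx.trans hρR, (hvu x (hx.trans ha)).eq_of_nhds]
  · simp [indicator, hgρ _ (sq_le_norm_sq hρ hx)]

lemma isTestFun_radial {d : ℕ} {g : ℝ → ℝ} (hg : ContDiff ℝ (⊤ : ℕ∞) g) {ρ : ℝ} (hρ : 0 ≤ ρ)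
    (hgρ : ∀ s, ρ ^ 2 ≤ s → g s = 0) : IsTestFun fun x : Euc d => g (‖x‖ ^ 2) :=
  ⟨hg.comp (contDiff_norm_sq ℝ), hasCompactSupport_of_norm_ge fun _ hx =>
    hgρ _ (sq_le_norm_sq hρ hx)⟩

/-- A nonnegative smooth radial profile of total mass one concentrated on a thin annulus. -/
lemma exists_radial_profile {d : ℕ} (hd : 1 ≤ d) {a b : ℝ} (ha : 0 ≤ a) (hab : a < b) :
    ∃ g : ℝ → ℝ, ContDiff ℝ (⊤ : ℕ∞) g ∧ (∀ s, 0 ≤ g s) ∧ (∀ s, s ≤ a ^ 2 → g s = 0) ∧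
      (∀ s, b ^ 2 ≤ s → g s = 0) ∧ ∫ x : Euc d, g (‖x‖ ^ 2) = 1 := by
  have hab2 : a ^ 2 < b ^ 2 := by gcongr
  have hb : 0 ≤ b := ha.trans hab.le
  let c : ℝ := (a ^ 2 + b ^ 2) / 2
  let β : ContDiffBump c :=
    ⟨(b ^ 2 - a ^ 2) / 4, (b ^ 2 - a ^ 2) / 2, by linarith, by linarith⟩
  have hβa : ∀ s, s ≤ a ^ 2 → β s = 0 := fun s hs => β.zero_of_le_dist <| by
    change (b ^ 2 - a ^ 2) / 2 ≤ |s - (a ^ 2 + b ^ 2) / 2|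
    rw [le_abs]; right; linarith
  have hβb : ∀ s, b ^ 2 ≤ s → β s = 0 := fun s hs => β.zero_of_le_dist <| by
    change (b ^ 2 - a ^ 2) / 2 ≤ |s - (a ^ 2 + b ^ 2) / 2|
    rw [le_abs]; left; linarith
  have hpos : 0 < ∫ x : Euc d, β (‖x‖ ^ 2) := by
    refine Continuous.integral_pos_of_hasCompactSupport_nonneg_nonzero
      (x := EuclideanSpace.single (⟨0, hd⟩ : Fin d) (√c)) (β.continuous.comp (by fun_prop))
      (hasCompactSupport_of_norm_ge fun x hx => hβb _ (sq_le_norm_sq hb hx))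
      (fun x => β.nonneg) (ne_of_gt (β.pos_of_mem_ball ?_))
    have hc : 0 ≤ c := by positivity
    simpa [Real.sq_sqrt hc] using β.rOut_pos
  refine ⟨fun s => (∫ x : Euc d, β (‖x‖ ^ 2))⁻¹ * β s, contDiff_const.mul β.contDiff,
    fun s => mul_nonneg (inv_nonneg.2 hpos.le) β.nonneg, fun s hs => by simp [hβa s hs],
    fun s hs => by simp [hβb s hs], ?_⟩
  rw [integral_const_mul, inv_mul_cancel₀ hpos.ne']

/-- Two real random variables with the same one-dimensional law, the law being recorded on
`Fin 1 → ℝ`, are identically distributed. -/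
lemma identDistrib_of_map_fin_one {Ω : Type} [MeasurableSpace Ω] {P : Measure Ω} {Y Z : Ω → ℝ}
    (hY : Measurable Y) (hZ : Measurable Z)
    (h : Measure.map (fun ω (_ : Fin 1) => Y ω) P = Measure.map (fun ω (_ : Fin 1) => Z ω) P) :
    IdentDistrib Y Z P P := by
  refine ⟨hY.aemeasurable, hZ.aemeasurable, ?_⟩
  have h0 : Measurable fun y : Fin 1 → ℝ => y 0 := measurable_pi_apply 0
  have := congrArg (Measure.map fun y : Fin 1 → ℝ => y 0) h
  rwa [Measure.map_map h0 (measurable_pi_lambda _ fun _ => hY),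
    Measure.map_map h0 (measurable_pi_lambda _ fun _ => hZ)] at this

namespace GFF

variable {d : ℕ} {Ω : Type} [MeasurableSpace Ω] (X : GFF d Ω)

lemma memLp_h {f : Euc d → ℝ} (hf : IsTestFun f) : MemLp (X.h 0 1 f) 2 X.P := by
  have h4 : MemLp (X.h 0 1 f) 4 X.P := by
    refine (integrable_norm_rpow_iff (X.meas_h 0 1 f).aestronglyMeasurable (by norm_num)
      (by norm_num)).1 ?_
    refine (X.mom4 f hf).congr (Eventually.of_forall fun ω => ?_)
    have : ((4 : ENNReal).toReal) = ((4 : ℕ) : ℝ) := by norm_num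
    simp only [this, Real.rpow_natCast, Real.norm_eq_abs]
    exact (Even.pow_abs (by decide) _).symm
  exact h4.mono_exponent (by norm_num)

lemma identDistrib_H {a : Euc d} {r : ℝ} (hr : 0 < r) (har : ball a r ⊆ ball (0 : Euc d) 1)
    {f : Euc d → ℝ} (hf : IsTestFun f) : IdentDistrib (X.H a r f) (X.h a r f) X.P X.P :=
  identDistrib_of_map_fin_one (X.meas_H a r f) (X.meas_h a r f)
    (X.dmp_law a r hr har 1 (fun _ => f) fun _ => hf)

lemma identDistrib_h_scaled {r : ℝ} (hr : 0 < r) {f : Euc d → ℝ}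
    (hf : IsTestFun fun x => f (r • x)) :
    IdentDistrib (X.h 0 r f) (fun ω => r ^ (1 + (d : ℝ) / 2) * X.h 0 1 (fun x => f (r • x)) ω)
      X.P X.P := by
  have h := X.scaling 0 r hr 1 (fun _ x => f (r • x)) fun _ => hf
  simp only [sub_zero, smul_inv_smul₀ hr.ne'] at h
  exact identDistrib_of_map_fin_one (X.meas_h 0 r f) ((X.meas_h 0 1 _).const_mul _) h

/-- The second moments in the domain Markov decomposition add up. -/
lemma integral_sq_h_eq {r : ℝ} (hr : 0 < r) (hr1 : r ≤ 1) {f : Euc d → ℝ} (hf : IsTestFun f)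
    (hf' : IsTestFun fun x => f (r • x)) :
    ∫ ω, X.h 0 1 f ω ^ 2 ∂X.P =
      (r ^ (1 + (d : ℝ) / 2)) ^ 2 * ∫ ω, X.h 0 1 (fun x => f (r • x)) ω ^ 2 ∂X.P +
        ∫ ω, X.Φ 0 r f ω ^ 2 ∂X.P := by
  have hsub : ball (0 : Euc d) r ⊆ ball 0 1 := ball_subset_ball hr1
  have hHh := X.identDistrib_H hr hsub hf
  have hHs := hHh.trans (X.identDistrib_h_scaled hr hf')
  have hH2 : MemLp (X.H 0 r f) 2 X.P := hHs.memLp_iff.2 ((X.memLp_h hf').const_mul _)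
  have hdec := X.dmp_decomp 0 r hr hsub f hf
  have hΦ2 : MemLp (X.Φ 0 r f) 2 X.P :=
    ((X.memLp_h hf).sub hH2).ae_eq (by filter_upwards [hdec] with ω hω; simp [hω])
  have hind : IndepFun (X.H 0 r f) (X.Φ 0 r f) X.P := by
    refine (IndepFun_iff_Indep _ _ _).2 (indep_of_indep_of_le (X.dmp_indep 0 r hr hsub) ?_ ?_)
    · exact le_iSup (fun g : {f : Euc d → ℝ // IsTestFun f} =>
        MeasurableSpace.comap (X.H 0 r g.1) inferInstance) ⟨f, hf⟩
    · exact le_sup_of_le_left (le_iSup (fun g : {f : Euc d → ℝ // IsTestFun f} =>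
        MeasurableSpace.comap (X.Φ 0 r g.1) inferInstance) ⟨f, hf⟩)
  have hcross : ∫ ω, X.H 0 r f ω * X.Φ 0 r f ω ∂X.P = 0 := by
    rw [hind.integral_fun_mul_eq_mul_integral (X.meas_H 0 r f).aestronglyMeasurable
      (X.meas_Φ 0 r f).aestronglyMeasurable, hHh.integral_eq, X.centered 0 r f hf, zero_mul]
  have hHsq : ∫ ω, X.H 0 r f ω ^ 2 ∂X.P =
      (r ^ (1 + (d : ℝ) / 2)) ^ 2 * ∫ ω, X.h 0 1 (fun x => f (r • x)) ω ^ 2 ∂X.P := by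
    rw [← integral_const_mul]
    simpa [mul_pow] using (hHs.pow (n := 2)).integral_eq
  have hcrossInt : Integrable (fun ω => X.H 0 r f ω * X.Φ 0 r f ω) X.P :=
    hH2.integrable_mul hΦ2
  calc ∫ ω, X.h 0 1 f ω ^ 2 ∂X.P
      = ∫ ω, (X.H 0 r f ω ^ 2 + 2 * (X.H 0 r f ω * X.Φ 0 r f ω) + X.Φ 0 r f ω ^ 2) ∂X.P := by
        refine integral_congr_ae ?_
        filter_upwards [hdec] with ω hω
        rw [hω]
        ring
    _ = _ := by
        rw [integral_add (by exact hH2.integrable_sq.add (hcrossInt.const_mul 2))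
            hΦ2.integrable_sq,
          integral_add hH2.integrable_sq (hcrossInt.const_mul 2), integral_const_mul, hcross,
          hHsq]
        ring

/-- Testing the harmonic part against a radial function gives a multiple of the spherical
average. -/
lemma Φ_radial_ae_eq {r : ℝ} (hr1 : r ≤ 1) {g : ℝ → ℝ}
    (hg : ContDiff ℝ (⊤ : ℕ∞) g) {ρ : ℝ} (hρ : 0 ≤ ρ) (hρr : ρ < r)
    (hgρ : ∀ s, ρ ^ 2 ≤ s → g s = 0) :
    ∀ᵐ ω ∂X.P, X.Φ 0 r (fun x => g (‖x‖ ^ 2)) ω =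
      X.sphAvg 0 r ω * ∫ x : Euc d, g (‖x‖ ^ 2) := by
  filter_upwards [X.dmp_harm 0 r (hρ.trans_lt hρr) (ball_subset_ball hr1)] with ω hω
  refine (hω.2 _ (isTestFun_radial hg hρ hgρ) ?_).trans
    (hω.1.setIntegral_mul_radial hg.continuous hρ hρr hgρ)
  refine (closure_minimal (fun x hx => ?_) isClosed_closedBall).trans
    (closedBall_subset_ball hρr)
  by_contra h
  exact hx (hgρ _ (sq_le_norm_sq hρ (le_of_lt (by simpa using h))))

/-- The second moment of the spherical average at the origin, in terms of the covariance of the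
field against a radial test function. -/
lemma integral_sq_h_radial {r : ℝ} (hr1 : r ≤ 1) {g : ℝ → ℝ}
    (hg : ContDiff ℝ (⊤ : ℕ∞) g) {ρ : ℝ} (hρ : 0 ≤ ρ) (hρr : ρ < r)
    (hgρ : ∀ s, ρ ^ 2 ≤ s → g s = 0) :
    ∫ ω, X.h 0 1 (fun x => g (‖x‖ ^ 2)) ω ^ 2 ∂X.P =
      (r ^ (1 + (d : ℝ) / 2)) ^ 2 *
          ∫ ω, X.h 0 1 (fun x => g (r ^ 2 * ‖x‖ ^ 2)) ω ^ 2 ∂X.P +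
        (∫ ω, X.sphAvg 0 r ω ^ 2 ∂X.P) * (∫ x : Euc d, g (‖x‖ ^ 2)) ^ 2 := by
  have hr : 0 < r := hρ.trans_lt hρr
  have hscale : (fun x : Euc d => g (‖r • x‖ ^ 2)) = fun x => g (r ^ 2 * ‖x‖ ^ 2) := by
    ext x
    rw [norm_smul, mul_pow, Real.norm_eq_abs, sq_abs]
  have htest : IsTestFun fun x : Euc d => g (‖r • x‖ ^ 2) := by
    rw [hscale]
    refine isTestFun_radial (g := fun s => g (r ^ 2 * s)) (ρ := ρ / r)
      (hg.comp (contDiff_const.mul contDiff_id)) (by positivity) fun s hs => hgρ _ ?_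
    rwa [div_pow, div_le_iff₀' (by positivity)] at hs
  rw [X.integral_sq_h_eq hr hr1 (isTestFun_radial hg hρ hgρ) htest, hscale, ← integral_mul_const]
  congr 1
  refine integral_congr_ae ?_
  filter_upwards [X.Φ_radial_ae_eq hr1 hg hρ hρr hgρ] with ω hω
  rw [hω, mul_pow]

lemma antitoneOn_integral_sq_sphAvg (hd : 1 ≤ d) :
    AntitoneOn (fun r : ℝ => ∫ ω, X.sphAvg 0 r ω ^ 2 ∂X.P) (Ioo (0 : ℝ) 1) := by
  intro s hs r hr hsr
  rcases hsr.eq_or_lt with rfl | hlt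
  · exact le_rfl
  have hs0 := hs.1
  have hr0 := hr.1
  obtain ⟨g, hg, -, -, hgρ, hg1⟩ := exists_radial_profile hd le_rfl (half_pos hs0)
  have hρ : 0 ≤ s / 2 := by linarith
  have h1 := X.integral_sq_h_radial hs.2.le hg hρ (half_lt_self hs0) hgρ
  have h2 := X.integral_sq_h_radial hr.2.le hg hρ ((half_lt_self hs0).trans hlt) hgρ
  have h3 := X.integral_sq_h_radial (r := s / r) (g := fun t => g (r ^ 2 * t)) (ρ := s / 2 / r)
    ((div_le_one hr0).2 hsr) (hg.comp (contDiff_const.mul contDiff_id)) (by positivity)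
    (by gcongr; exact half_lt_self hs0)
    (fun t ht => hgρ _ (by rwa [div_pow _ r, div_le_iff₀' (by positivity)] at ht))
  have hmul : ∀ t : ℝ, r ^ 2 * ((s / r) ^ 2 * t) = s ^ 2 * t := fun t => by
    field_simp
  simp only [hmul] at h3
  rw [Real.div_rpow hs0.le hr0.le] at h3
  have hw : 0 < r ^ (1 + (d : ℝ) / 2) := Real.rpow_pos_of_pos hr0 _
  rw [hg1] at h1 h2
  have hnn : 0 ≤ (∫ ω, X.sphAvg 0 (s / r) ω ^ 2 ∂X.P) *
      (∫ x : Euc d, g (r ^ 2 * ‖x‖ ^ 2)) ^ 2 :=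
    mul_nonneg (integral_nonneg fun ω => sq_nonneg _) (sq_nonneg _)
  have h4 : (s ^ (1 + (d : ℝ) / 2)) ^ 2 *
      ∫ ω, X.h 0 1 (fun x => g (s ^ 2 * ‖x‖ ^ 2)) ω ^ 2 ∂X.P ≤
      (r ^ (1 + (d : ℝ) / 2)) ^ 2 *
        ∫ ω, X.h 0 1 (fun x => g (r ^ 2 * ‖x‖ ^ 2)) ω ^ 2 ∂X.P := by
    rw [h3, mul_add, ← mul_assoc, ← mul_pow, mul_div_cancel₀ _ hw.ne']
    exact le_add_of_nonneg_right (mul_nonneg (sq_nonneg _) hnn)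
  change ∫ ω, X.sphAvg 0 r ω ^ 2 ∂X.P ≤ ∫ ω, X.sphAvg 0 s ω ^ 2 ∂X.P
  linarith

lemma tendsto_integral_sq_sphAvg (hd : 1 ≤ d) :
    Tendsto (fun r : ℝ => ∫ ω, X.sphAvg 0 r ω ^ 2 ∂X.P) (𝓝[<] 1) (𝓝 0) := by
  let δ : ℕ → ℝ := fun n => 1 / ((n : ℝ) + 1) / 4
  have hδ0 : ∀ n, 0 < δ n := fun n => by positivity
  have hδ1 : ∀ n, δ n ≤ 1 / 4 := fun n => by
    have : 1 / ((n : ℝ) + 1) ≤ 1 := by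
      rw [div_le_one (by positivity)]
      linarith [n.cast_nonneg (α := ℝ)]
    simp only [δ]
    linarith
  have hδ : Tendsto δ atTop (𝓝 0) := by
    simpa [δ] using (tendsto_one_div_add_atTop_nhds_zero_nat (𝕜 := ℝ)).div_const 4
  have hlo : ∀ n, 0 ≤ 1 - 3 * δ n := fun n => by linarith [hδ1 n]
  have hmid : ∀ n, 0 ≤ 1 - 2 * δ n := fun n => by linarith [hδ1 n]
  choose g hg hg0 hga hgb hg1 using fun n =>
    exists_radial_profile hd (hlo n) (by linarith [hδ0 n] : 1 - 3 * δ n < 1 - 2 * δ n)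
  let f : ℕ → Euc d → ℝ := fun n x => g n (‖x‖ ^ 2)
  have hsupp : ∀ n, ∀ x ∈ tsupport (f n), 1 - 3 * δ n ≤ ‖x‖ := by
    intro n
    refine closure_minimal (fun x hx => ?_) (isClosed_le continuous_const continuous_norm)
    change 1 - 3 * δ n ≤ ‖x‖
    by_contra! h
    exact hx (hga n _ (by gcongr))
  have hsupp' : ∀ n, ∃ x ∈ tsupport (f n), ‖x‖ ≤ 1 := by
    intro n
    by_contra! h
    have hz : ∀ x, f n x = 0 := by
      intro x
      by_contra hx
      refine hx (hgb n _ (sq_le_norm_sq (hmid n) ?_))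
      linarith [h x (subset_tsupport _ hx), hδ0 n]
    have := hg1 n
    simp only [f] at hz
    simp [hz] at this
  have hQ := X.zero_bdry f (fun n => isTestFun_radial (hg n) (hmid n) (hgb n))
    (fun n x => hg0 n _) ⟨1, fun n => (hg1 n).le⟩ ?_
    ⟨1, fun n x y hxy _ => by simp [f, hxy]⟩
  · have hbound : ∀ n, ∫ ω, X.sphAvg 0 (1 - δ n) ω ^ 2 ∂X.P ≤
        ∫ ω, X.h 0 1 (f n) ω ^ 2 ∂X.P := by
      intro n
      have h := X.integral_sq_h_radial (r := 1 - δ n) (by linarith [hδ0 n]) (hg n) (hmid n)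
        (by linarith [hδ0 n]) (hgb n)
      rw [hg1 n, one_pow, mul_one] at h
      rw [h]
      exact le_add_of_nonneg_left
        (mul_nonneg (sq_nonneg _) (integral_nonneg fun ω => sq_nonneg _))
    refine tendsto_order.2 ⟨fun a ha => Eventually.of_forall fun r =>
      ha.trans_le (integral_nonneg fun ω => sq_nonneg _), fun a ha => ?_⟩
    obtain ⟨n, hn⟩ := (hQ.eventually_lt_const ha).exists
    filter_upwards [Ioo_mem_nhdsLT (show 1 - δ n < 1 by linarith [hδ0 n])] with r hr
    have hn0 : 0 < 1 - δ n := by linarith [hδ1 n]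
    exact (X.antitoneOn_integral_sq_sphAvg hd ⟨hn0, hr.1.trans hr.2⟩ ⟨hn0.trans hr.1, hr.2⟩
      hr.1.le).trans_lt ((hbound n).trans_lt hn)
  · have hlim : Tendsto (fun n => 1 - 3 * δ n) atTop (𝓝 1) := by
      simpa using (hδ.const_mul 3).const_sub 1
    refine tendsto_of_tendsto_of_tendsto_of_le_of_le hlim tendsto_const_nhds (fun n => ?_)
      fun n => ?_
    · obtain ⟨x, hx, -⟩ := hsupp' n
      refine (le_infDist ⟨x, hx⟩).2 fun y hy => ?_
      simpa using hsupp n y hy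
    · obtain ⟨x, hx, hx1⟩ := hsupp' n
      exact (infDist_le_dist_of_mem hx).trans (by simpa using hx1)

end GFF

/-- the spherical average at the origin has zero boundary values in L²:
`r ↦ E[h_r(0)²]` is nonincreasing on `(0,1)` and tends to `0` as `r ↑ 1`. -/
theorem statement7 (d : ℕ) (hd : 2 ≤ d) (Ω : Type) [MeasurableSpace Ω] (X : GFF d Ω) :
    AntitoneOn (fun r : ℝ => ∫ ω, (X.sphAvg 0 r ω) ^ 2 ∂X.P) (Set.Ioo (0 : ℝ) 1) ∧
    Tendsto (fun r : ℝ => ∫ ω, (X.sphAvg 0 r ω) ^ 2 ∂X.P)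
      (𝓝[Set.Iio (1 : ℝ)] 1) (𝓝 0) := by
  exact ⟨X.antitoneOn_integral_sq_sphAvg (by omega), X.tendsto_integral_sq_sphAvg (by omega)⟩
end
end

section
/- Characterisation of the Green's function: let d ≥ 2, y ∈ 𝔹, b > 0, and let k : 𝔹 ∖ {y} → ℝ be harmonic on 𝔹 ∖ {y}, such that x ↦ k(x) − b·s(|x − y|) is bounded in some punctured neighbourhood of y, and such that ∫_𝔹 k(x) f_n(x) dx → 0 as n → ∞ for every sequence (f_n) of smooth nonnegative functions with ∫ f_n uniformly bounded, dist(supp(f_n), 0) → 1, and sup_n sup_{r<1} sup_{x,y' ∈ ∂(r𝔹)} f_n(x)/f_n(y') < ∞. Then k(x) = b·G^𝔹(x, y) for all x ∈ 𝔹 ∖ {y}. -/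
open MeasureTheory ProbabilityTheory Metric Filter Topology Set

noncomputable section

/-- The partial derivative in the `i`-th coordinate direction. -/
def pd {d : ℕ} (i : Fin d) (u : Euc d → ℝ) (x : Euc d) : ℝ :=
  fderiv ℝ u x (EuclideanSpace.single i 1)

lemma pd_congr {d : ℕ} {i : Fin d} {u v : Euc d → ℝ} {x : Euc d} (h : u =ᶠ[𝓝 x] v) :
    pd i u =ᶠ[𝓝 x] pd i v := by
  filter_upwards [h.fderiv (𝕜 := ℝ)] with y hy
  simp only [pd, hy]

lemma lap_congr {d : ℕ} {u v : Euc d → ℝ} {x : Euc d} (h : u =ᶠ[𝓝 x] v) :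
    lap u x = lap v x := by
  simp only [lap, (h.iteratedFDeriv ℝ 2).eq_of_nhds]

lemma differentiableAt_pd {d : ℕ} (i : Fin d) {u : Euc d → ℝ} {x : Euc d}
    (hu : ContDiffAt ℝ 2 u x) : DifferentiableAt ℝ (pd i u) x := by
  have h : DifferentiableAt ℝ (fderiv ℝ u) x :=
    (hu.fderiv_right (m := 1) (by norm_num)).differentiableAt (by norm_num)
  exact h.clm_apply (differentiableAt_const _)

lemma contDiff_pd {d : ℕ} (i : Fin d) {u : Euc d → ℝ} (hu : ContDiff ℝ (⊤ : ℕ∞) u) :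
    ContDiff ℝ (⊤ : ℕ∞) (pd i u) :=
  (hu.fderiv_right (m := (⊤ : ℕ∞)) (by simp)).clm_apply contDiff_const

lemma lap_eq_sum_pd {d : ℕ} {u : Euc d → ℝ} {x : Euc d} (hu : ContDiffAt ℝ 2 u x) :
    lap u x = ∑ i, pd i (pd i u) x := by
  have h : DifferentiableAt ℝ (fderiv ℝ u) x :=
    (hu.fderiv_right (m := 1) (by norm_num)).differentiableAt (by norm_num)
  refine Finset.sum_congr rfl fun i _ => ?_
  rw [iteratedFDeriv_two_apply]
  unfold pd
  rw [fderiv_clm_apply h (differentiableAt_const _)]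
  simp

lemma ContDiff.contDiffAt_two {d : ℕ} {u : Euc d → ℝ} (hu : ContDiff ℝ (⊤ : ℕ∞) u) (x : Euc d) :
    ContDiffAt ℝ 2 u x :=
  (contDiff_infty.1 hu 2).contDiffAt

lemma ContDiff.lap {d : ℕ} {u : Euc d → ℝ} (hu : ContDiff ℝ (⊤ : ℕ∞) u) :
    ContDiff ℝ (⊤ : ℕ∞) (lap u) := by
  have h : _root_.lap u = fun x => ∑ i, pd i (pd i u) x :=
    funext fun x => lap_eq_sum_pd (hu.contDiffAt_two x)
  rw [h]
  exact ContDiff.sum fun i _ => contDiff_pd i (contDiff_pd i hu)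

lemma lap_sub {d : ℕ} {u v : Euc d → ℝ} {x : Euc d} (hu : ContDiffAt ℝ 2 u x)
    (hv : ContDiffAt ℝ 2 v x) : lap (fun y => u y - v y) x = lap u x - lap v x := by
  have := iteratedFDeriv_sub_apply (𝕜 := ℝ) (i := 2) hu hv
  change iteratedFDeriv ℝ 2 (fun y => u y - v y) x = _ at this
  simp only [lap, this, sub_apply, Finset.sum_sub_distrib]

lemma lap_const_mul {d : ℕ} {u : Euc d → ℝ} {x : Euc d} (c : ℝ) (hu : ContDiffAt ℝ 2 u x) :
    lap (fun y => c * u y) x = c * lap u x := by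
  have := iteratedFDeriv_const_smul_apply (𝕜 := ℝ) (i := 2) (a := c) hu
  change iteratedFDeriv ℝ 2 (fun y => c * u y) x = _ at this
  simp only [lap, this, smul_apply, Finset.mul_sum, smul_eq_mul]

lemma pd_mul {d : ℕ} (i : Fin d) {u v : Euc d → ℝ} {x : Euc d} (hu : DifferentiableAt ℝ u x)
    (hv : DifferentiableAt ℝ v x) :
    pd i (fun y => u y * v y) x = u x * pd i v x + v x * pd i u x := by
  simp only [pd, fderiv_fun_mul hu hv]
  simp

lemma pd_add {d : ℕ} (i : Fin d) {u v : Euc d → ℝ} {x : Euc d} (hu : DifferentiableAt ℝ u x)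
    (hv : DifferentiableAt ℝ v x) :
    pd i (fun y => u y + v y) x = pd i u x + pd i v x := by
  simp only [pd, fderiv_fun_add hu hv]
  simp

lemma pd_sub {d : ℕ} (i : Fin d) {u v : Euc d → ℝ} {x : Euc d} (hu : DifferentiableAt ℝ u x)
    (hv : DifferentiableAt ℝ v x) :
    pd i (fun y => u y - v y) x = pd i u x - pd i v x := by
  simp only [pd, fderiv_fun_sub hu hv]
  simp

lemma lap_mul {d : ℕ} {u v : Euc d → ℝ} (hu : ContDiff ℝ (⊤ : ℕ∞) u)
    (hv : ContDiff ℝ (⊤ : ℕ∞) v) (x : Euc d) :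
    lap (fun y => u y * v y) x =
      u x * lap v x + v x * lap u x + 2 * ∑ i, pd i u x * pd i v x := by
  have h2 : ∀ {f : Euc d → ℝ}, ContDiff ℝ (⊤ : ℕ∞) f → ContDiffAt ℝ 2 f x :=
    fun hf => hf.contDiffAt_two x
  have hd : ∀ {f : Euc d → ℝ}, ContDiff ℝ (⊤ : ℕ∞) f → Differentiable ℝ f :=
    fun hf => hf.differentiable (by simp)
  rw [lap_eq_sum_pd (h2 (hu.mul hv)), lap_eq_sum_pd (h2 hu), lap_eq_sum_pd (h2 hv),
    Finset.mul_sum, Finset.mul_sum, Finset.mul_sum, ← Finset.sum_add_distrib,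
    ← Finset.sum_add_distrib]
  refine Finset.sum_congr rfl fun i _ => ?_
  have h1 : pd i (fun y => u y * v y) = fun y => u y * pd i v y + v y * pd i u y :=
    funext fun y => pd_mul i (hd hu y) (hd hv y)
  have hpu := hd (contDiff_pd i hu)
  have hpv := hd (contDiff_pd i hv)
  rw [h1, pd_add (u := fun y => u y * pd i v y) (v := fun y => v y * pd i u y) i
    ((hd hu x).mul (hpv x)) ((hd hv x).mul (hpu x)), pd_mul i (hd hu x) (hpv x),
    pd_mul i (hd hv x) (hpu x)]
  ring

/-- The integral of a partial derivative of a compactly supported function vanishes. -/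
lemma integral_pd_eq_zero {d : ℕ} (i : Fin d) {v : Euc d → ℝ} (hv : Differentiable ℝ v)
    (hc : HasCompactSupport v) (hpd : Continuous (pd i v)) : ∫ x, pd i v x = 0 := by
  have hpdc : HasCompactSupport (pd i v) :=
    hc.fderiv_apply (𝕜 := ℝ) (EuclideanSpace.single i 1)
  have := integral_mul_fderiv_eq_neg_fderiv_mul_of_integrable (𝕜 := ℝ) (μ := volume)
    (f := fun _ : Euc d => (1 : ℝ)) (g := v) (v := EuclideanSpace.single i 1)
    (by simp) (by simp only [one_mul]; exact hpd.integrable_of_hasCompactSupport hpdc)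
    (by simpa using hv.continuous.integrable_of_hasCompactSupport hc)
    (fun x _ => differentiableAt_const _) (fun x _ => hv x)
  simpa [pd] using this

/-- A harmonic function is weakly harmonic. -/
lemma integral_mul_lap_eq_zero {d : ℕ} {u ψ : Euc d → ℝ} {U : Set (Euc d)} (hU : IsOpen U)
    (hu : IsHarmonicOn u U) (hψ : ContDiff ℝ (⊤ : ℕ∞) ψ) (hc : HasCompactSupport ψ)
    (hsub : tsupport ψ ⊆ U) : ∫ x, u x * lap ψ x = 0 := by
  have hu2 : ∀ x ∈ U, ContDiffAt ℝ 2 u x := fun x hx => hu.1.contDiffAt (hU.mem_nhds hx)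
  have hψ2 : ∀ x, ContDiffAt ℝ 2 ψ x := fun x => hψ.contDiffAt_two x
  have hψd : Differentiable ℝ ψ := hψ.differentiable (by simp)
  have hpψd : ∀ i, Differentiable ℝ (pd i ψ) := fun i =>
    (contDiff_pd i hψ).differentiable (by simp)
  have hzero : ∀ x, x ∉ tsupport ψ → ψ =ᶠ[𝓝 x] fun _ => 0 := fun x hx =>
    notMem_tsupport_iff_eventuallyEq.1 hx
  let v : Fin d → Euc d → ℝ := fun i x => u x * pd i ψ x - ψ x * pd i u x
  have hv0 : ∀ i x, x ∉ tsupport ψ → v i =ᶠ[𝓝 x] fun _ => 0 := by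
    intro i x hx
    filter_upwards [hzero x hx, pd_congr (i := i) (hzero x hx)] with y h1 h2
    have : pd i ψ y = 0 := by rw [h2]; simp [pd]
    simp only [v, this, h1]; ring
  have hpdv : ∀ i, ∀ x ∈ U, pd i (v i) x = u x * pd i (pd i ψ) x - ψ x * pd i (pd i u) x := by
    intro i x hx
    have hud := (hu2 x hx).differentiableAt (by norm_num)
    have hpud := differentiableAt_pd i (hu2 x hx)
    rw [pd_sub (u := fun y => u y * pd i ψ y) (v := fun y => ψ y * pd i u y) i
      (hud.mul (hpψd i x)) ((hψd x).mul hpud), pd_mul i hud (hpψd i x),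
      pd_mul i (hψd x) hpud]
    ring
  have hpdv0 : ∀ i x, x ∉ tsupport ψ → pd i (v i) =ᶠ[𝓝 x] fun _ => 0 := by
    intro i x hx
    filter_upwards [pd_congr (i := i) (hv0 i x hx)] with y hy
    rw [hy]; simp [pd]
  have hvd : ∀ i, Differentiable ℝ (v i) := by
    intro i x
    by_cases hx : x ∈ tsupport ψ
    · have hxU := hsub hx
      exact (((hu2 x hxU).differentiableAt (by norm_num)).mul (hpψd i x)).sub
        ((hψd x).mul (differentiableAt_pd i (hu2 x hxU)))
    · exact (differentiableAt_const (0 : ℝ)).congr_of_eventuallyEq (hv0 i x hx)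
  have hvc : ∀ i, HasCompactSupport (v i) := fun i => HasCompactSupport.intro hc
    fun x hx => (hv0 i x hx).eq_of_nhds
  have hpc : ∀ i, Continuous (pd i (v i)) := by
    intro i
    rw [continuous_iff_continuousAt]
    intro x
    by_cases hx : x ∈ tsupport ψ
    · have hxU := hsub hx
      have hv1 : ContDiffAt ℝ 1 (v i) x := by
        have h1 : ContDiffAt ℝ 1 (pd i u) x :=
          ((hu2 x hxU).fderiv_right (m := 1) (by norm_num)).clm_apply contDiffAt_const
        have h2 : ContDiffAt ℝ 1 (pd i ψ) x :=
          ((hψ2 x).fderiv_right (m := 1) (by norm_num)).clm_apply contDiffAt_const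
        exact (((hu2 x hxU).of_le (by norm_num)).mul h2).sub
          (((hψ2 x).of_le (by norm_num)).mul h1)
      have : ContDiffAt ℝ 0 (pd i (v i)) x :=
        (hv1.fderiv_right (m := 0) (by norm_num)).clm_apply contDiffAt_const
      exact this.continuousAt
    · exact continuousAt_const.congr (hpdv0 i x hx).symm
  have hpd0 : ∀ i, pd i (fun _ : Euc d => (0 : ℝ)) = fun _ => 0 := fun i => funext fun x => by
    simp [pd]
  have hsum : ∀ x, u x * lap ψ x = ∑ i, pd i (v i) x := by
    intro x
    by_cases hx : x ∈ tsupport ψ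
    · have hxU := hsub hx
      have hl := hu.2 x hxU
      rw [lap_eq_sum_pd (hu2 x hxU)] at hl
      rw [Finset.sum_congr rfl fun i _ => hpdv i x hxU, Finset.sum_sub_distrib, ← Finset.mul_sum,
        ← Finset.mul_sum, hl, lap_eq_sum_pd (hψ2 x)]
      ring
    · rw [lap_congr (hzero x hx), Finset.sum_congr rfl fun i _ => (hpdv0 i x hx).eq_of_nhds]
      simp [lap_eq_sum_pd contDiffAt_const, hpd0]
  simp_rw [hsum]
  rw [integral_finsetSum]
  · exact Finset.sum_eq_zero fun i _ => integral_pd_eq_zero i (hvd i) (hvc i) (hpc i)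
  · intro i _
    exact (hpc i).integrable_of_hasCompactSupport
      ((hvc i).fderiv_apply (𝕜 := ℝ) (EuclideanSpace.single i 1))

lemma pd_comp_quadratic {d : ℕ} (i : Fin d) {p : Euc d → ℝ} {γ c : ℝ} {v : Euc d}
    (hp : ∀ x, p x = γ * ‖x‖ ^ 2 + inner ℝ v x + c) {w : ℝ → ℝ} (hw : Differentiable ℝ w)
    (x : Euc d) : pd i (fun y => w (p y)) x = deriv w (p x) * (2 * γ * x i + v i) := by
  have hpx : HasFDerivAt p (γ • (2 • innerSL ℝ x) + innerSL ℝ v) x := by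
    have h1 := ((hasStrictFDerivAt_norm_sq x).hasFDerivAt.const_mul γ).add
      (innerSL ℝ v).hasFDerivAt
    refine (h1.add_const c).congr_of_eventuallyEq (Eventually.of_forall fun y => ?_)
    simp [hp y]
  have h := ((hw (p x)).hasDerivAt.comp_hasFDerivAt x hpx)
  unfold pd
  have h' : fderiv ℝ (fun y => w (p y)) x = _ := h.fderiv
  rw [h']
  simp [EuclideanSpace.inner_single_right]
  ring

/-- The Laplacian of a function of a quadratic polynomial that is a perfect square. -/
lemma lap_comp_quadratic {d : ℕ} {p : Euc d → ℝ} {γ c : ℝ} {v : Euc d}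
    (hp : ∀ x, p x = γ * ‖x‖ ^ 2 + inner ℝ v x + c) (hv : ‖v‖ ^ 2 = 4 * γ * c) {w : ℝ → ℝ}
    (hw : ContDiff ℝ (⊤ : ℕ∞) w) (x : Euc d) :
    lap (fun y => w (p y)) x =
      γ * (4 * p x * deriv (deriv w) (p x) + 2 * d * deriv w (p x)) := by
  have hpc : ContDiff ℝ (⊤ : ℕ∞) p := by
    rw [funext hp]
    exact ((contDiff_const.mul (contDiff_norm_sq ℝ)).add (innerSL ℝ v).contDiff).add contDiff_const
  have hw' : ContDiff ℝ (⊤ : ℕ∞) (deriv w) := by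
    have := (contDiff_infty_iff_deriv (𝕜 := ℝ) (f := w)).1 hw
    exact this.2
  have hwd : Differentiable ℝ w := hw.differentiable (by simp)
  have hwd' : Differentiable ℝ (deriv w) := hw'.differentiable (by simp)
  have hlin : ∀ i : Fin d, pd i (fun y : Euc d => 2 * γ * y i + v i) x = 2 * γ := by
    intro i
    have h : HasFDerivAt (fun y : Euc d => 2 * γ * y i + v i)
        ((2 * γ) • (EuclideanSpace.proj i : Euc d →L[ℝ] ℝ)) x :=
      ((EuclideanSpace.proj i : Euc d →L[ℝ] ℝ).hasFDerivAt.const_mul (2 * γ)).add_const _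
    unfold pd
    rw [h.fderiv]
    simp
  have hsq : ∑ i, (2 * γ * x i + v i) ^ 2 = 4 * γ * p x := by
    have h1 : ∑ i, (2 * γ * x i + v i) ^ 2 = ‖(2 * γ) • x + v‖ ^ 2 := by
      rw [EuclideanSpace.norm_sq_eq]; simp
    rw [h1, norm_add_sq_real, norm_smul, mul_pow, hv, hp, inner_smul_left, Real.norm_eq_abs,
      sq_abs, real_inner_comm]
    simp
    ring
  have h2 : ∀ i : Fin d, pd i (pd i fun y => w (p y)) x =
      deriv w (p x) * (2 * γ) + deriv (deriv w) (p x) * (2 * γ * x i + v i) ^ 2 := by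
    intro i
    rw [funext (pd_comp_quadratic i hp hwd), pd_mul i, hlin, pd_comp_quadratic i hp hwd']
    · ring
    · exact (hwd' _).comp x (hpc.differentiable (by simp) x)
    · fun_prop
  have hwp : ContDiff ℝ (⊤ : ℕ∞) fun y => w (p y) := hw.comp hpc
  rw [lap_eq_sum_pd (hwp.contDiffAt_two x),
    Finset.sum_congr rfl fun i _ => h2 i, Finset.sum_add_distrib,
    ← Finset.mul_sum _ _ (deriv (deriv w) (p x)), hsq]
  simp
  ring

lemma deriv_smoothTransition_of_nonpos {x : ℝ} (hx : x ≤ 0) :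
    deriv Real.smoothTransition x = 0 :=
  IsLocalMin.deriv_eq_zero <| Eventually.of_forall fun y => by
    rw [Real.smoothTransition.zero_of_nonpos hx]; exact Real.smoothTransition.nonneg y

lemma deriv_smoothTransition_of_one_le {x : ℝ} (hx : 1 ≤ x) :
    deriv Real.smoothTransition x = 0 :=
  IsLocalMax.deriv_eq_zero <| Eventually.of_forall fun y => by
    rw [Real.smoothTransition.one_of_one_le hx]; exact Real.smoothTransition.le_one y

lemma contDiff_smoothTransition : ContDiff ℝ (⊤ : ℕ∞) Real.smoothTransition :=
  Real.smoothTransition.contDiff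

lemma contDiff_deriv {f : ℝ → ℝ} (hf : ContDiff ℝ (⊤ : ℕ∞) f) : ContDiff ℝ (⊤ : ℕ∞) (deriv f) :=
  (contDiff_infty_iff_deriv.1 hf).2

lemma hasCompactSupport_deriv_smoothTransition :
    HasCompactSupport (deriv Real.smoothTransition) :=
  HasCompactSupport.intro (isCompact_Icc (a := (0 : ℝ)) (b := 1)) fun x hx => by
    rcases not_and_or.1 hx with h | h
    · exact deriv_smoothTransition_of_nonpos (not_le.1 h).le
    · exact deriv_smoothTransition_of_one_le (not_le.1 h).le

lemma exists_bound_deriv_smoothTransition :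
    ∃ C : ℝ, 0 < C ∧ (∀ x, |deriv Real.smoothTransition x| ≤ C) ∧
      ∀ x, |deriv (deriv Real.smoothTransition) x| ≤ C := by
  have h1 := contDiff_deriv contDiff_smoothTransition
  have h2 := contDiff_deriv h1
  obtain ⟨C₁, hC₁⟩ := h1.continuous.bounded_above_of_compact_support
    hasCompactSupport_deriv_smoothTransition
  obtain ⟨C₂, hC₂⟩ := h2.continuous.bounded_above_of_compact_support
    hasCompactSupport_deriv_smoothTransition.deriv
  exact ⟨max 1 (max C₁ C₂), by positivity,
    fun x => (hC₁ x).trans ((le_max_left _ _).trans (le_max_right _ _)),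
    fun x => (hC₂ x).trans ((le_max_right _ _).trans (le_max_right _ _))⟩

/-- The scaling function `s` as a function of the squared radius. -/
def sProfile (d : ℕ) (t : ℝ) : ℝ := sFun d (Real.sqrt t)

lemma sProfile_norm_sq {d : ℕ} (x : Euc d) : sProfile d (‖x‖ ^ 2) = sFun d ‖x‖ := by
  rw [sProfile, Real.sqrt_sq (norm_nonneg x)]

lemma exists_hasDerivAt_sProfile {d : ℕ} (hd : 2 ≤ d) :
    ∃ a : ℝ, 0 < a ∧ ∀ t : ℝ, 0 < t → HasDerivAt (sProfile d) (-a * t ^ (-(d : ℝ) / 2)) t := by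
  rcases hd.eq_or_lt with rfl | hd3
  · refine ⟨1 / 2, by norm_num, fun t ht => ?_⟩
    have h := (Real.hasDerivAt_log ht.ne').const_mul (-(1 / 2 : ℝ))
    have heq : sProfile 2 =ᶠ[𝓝 t] fun t => -(1 / 2 : ℝ) * Real.log t := by
      filter_upwards [lt_mem_nhds ht] with u hu
      simp [sProfile, sFun, Real.log_sqrt hu.le]
      ring
    refine (h.congr_of_eventuallyEq heq).congr_deriv ?_
    norm_num [Real.rpow_neg_one]
  · have hd' : (2 : ℝ) < d := by exact_mod_cast hd3
    refine ⟨((d : ℝ) - 2) / 2, by linarith, fun t ht => ?_⟩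
    have h := Real.hasDerivAt_rpow_const (x := t) (p := (2 - (d : ℝ)) / 2) (Or.inl ht.ne')
    have heq : sProfile d =ᶠ[𝓝 t] fun t => t ^ ((2 - (d : ℝ)) / 2) := by
      filter_upwards [lt_mem_nhds ht] with u hu
      rw [sProfile, sFun, if_neg (by omega), Real.sqrt_eq_rpow, ← Real.rpow_mul hu.le]
      congr 1
      ring
    refine (h.congr_of_eventuallyEq heq).congr_deriv ?_
    rw [show (2 - (d : ℝ)) / 2 - 1 = -(d : ℝ) / 2 by ring]
    ring

lemma tendsto_sProfile_zero {d : ℕ} (hd : 2 ≤ d) :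
    Tendsto (sProfile d) (𝓝[>] 0) atTop := by
  rcases hd.eq_or_lt with rfl | hd3
  · have h : Tendsto (fun t => (1 / 2 : ℝ) * -Real.log t) (𝓝[>] 0) atTop :=
      (tendsto_neg_atBot_atTop.comp Real.tendsto_log_nhdsGT_zero).const_mul_atTop (by norm_num)
    refine h.congr' ?_
    filter_upwards [self_mem_nhdsWithin] with u hu
    simp [sProfile, sFun, Real.log_sqrt (le_of_lt hu)]
    ring
  · have hd' : (2 : ℝ) < d := by exact_mod_cast hd3
    have h := tendsto_rpow_neg_nhdsGT_zero (y := (2 - (d : ℝ)) / 2) (by linarith)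
    refine h.congr' ?_
    filter_upwards [self_mem_nhdsWithin] with u hu
    rw [sProfile, sFun, if_neg (by omega), Real.sqrt_eq_rpow, ← Real.rpow_mul (le_of_lt hu)]
    congr 1
    ring

/-- `radialLap d w (‖x‖ ^ 2)` is the Laplacian of `x ↦ w (‖x‖ ^ 2)` in dimension `d`. -/
def radialLap (d : ℕ) (w : ℝ → ℝ) (t : ℝ) : ℝ := 4 * t * deriv (deriv w) t + 2 * d * deriv w t

/-- `w` is a smooth superharmonic truncation at squared radius `τ` of `sProfile d`. -/
structure IsTruncatedProfile (d : ℕ) (C τ : ℝ) (w : ℝ → ℝ) : Prop where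
  contDiff : ContDiff ℝ (⊤ : ℕ∞) w
  eq_of_ge : ∀ t, τ ≤ t → w t = sProfile d t
  eq_of_le : ∀ t, t ≤ τ / 2 → w t = w 0
  antitone : Antitone w
  abs_deriv_le : ∀ t, 0 < t → |deriv w t| ≤ C * t ^ (-(d : ℝ) / 2)
  radialLap_nonpos : ∀ t, radialLap d w t ≤ 0
  le_radialLap : ∀ t, -(C * τ ^ (-(d : ℝ) / 2)) ≤ radialLap d w t
  radialLap_of_ge : ∀ t, τ ≤ t → radialLap d w t = 0
  exists_radialLap_neg : ∃ t, 0 < t ∧ radialLap d w t < 0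

lemma exists_isTruncatedProfile {d : ℕ} (hd : 2 ≤ d) :
    ∃ C : ℝ, 0 < C ∧ ∀ τ, 0 < τ → ∃ w, IsTruncatedProfile d C τ w := by
  obtain ⟨a, ha, hg⟩ := exists_hasDerivAt_sProfile hd
  obtain ⟨C₀, hC₀, hC₁, -⟩ := exists_bound_deriv_smoothTransition
  have hd' : (2 : ℝ) ≤ d := by exact_mod_cast hd
  set e : ℝ := -(d : ℝ) / 2 with he
  refine ⟨max a (4 * a * C₀ * (1 / 2) ^ e), by positivity, fun τ hτ => ?_⟩
  let χ : ℝ → ℝ := fun t => Real.smoothTransition (2 / τ * t - 1)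
  have hχs : ContDiff ℝ (⊤ : ℕ∞) χ :=
    contDiff_smoothTransition.comp ((contDiff_const.mul contDiff_id).sub contDiff_const)
  have hχ0 : ∀ t, t ≤ τ / 2 → χ t = 0 := fun t ht =>
    Real.smoothTransition.zero_of_nonpos <| by
      have : 2 / τ * t ≤ 2 / τ * (τ / 2) := by gcongr
      have h2 : 2 / τ * (τ / 2) = 1 := by field_simp
      linarith
  have hχ1 : ∀ t, τ ≤ t → χ t = 1 := fun t ht =>
    Real.smoothTransition.one_of_one_le <| by
      have : 2 / τ * τ ≤ 2 / τ * t := by gcongr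
      have h2 : 2 / τ * τ = 2 := by field_simp
      linarith
  have hχd : ∀ t, deriv χ t = 2 / τ * deriv Real.smoothTransition (2 / τ * t - 1) := by
    intro t
    have h1 : HasDerivAt (fun t : ℝ => 2 / τ * t - 1) (2 / τ) t := by
      simpa using ((hasDerivAt_id t).const_mul (2 / τ)).sub_const 1
    have h2 := (contDiff_smoothTransition.differentiable (by simp)
      (2 / τ * t - 1)).hasDerivAt.comp t h1
    rw [mul_comm]
    exact h2.deriv
  have hχd1 : ∀ t, τ ≤ t → deriv χ t = 0 := fun t ht => by
    rw [hχd, deriv_smoothTransition_of_one_le, mul_zero]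
    have : 2 / τ * τ ≤ 2 / τ * t := by gcongr
    have h2 : 2 / τ * τ = 2 := by field_simp
    linarith
  have hχdnn : ∀ t, 0 ≤ deriv χ t := fun t => by
    rw [hχd]
    exact mul_nonneg (by positivity) Real.smoothTransition.monotone.deriv_nonneg
  have hχnn : ∀ t, 0 ≤ χ t := fun t => Real.smoothTransition.nonneg _
  have hχle : ∀ t, χ t ≤ 1 := fun t => Real.smoothTransition.le_one _
  let D : ℝ → ℝ := fun t => -a * (χ t * t ^ e)
  have hD0 : ∀ t, t ≤ τ / 2 → D t = 0 := fun t ht => by simp [D, hχ0 t ht]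
  have hD0' : ∀ t, t < τ / 2 → D =ᶠ[𝓝 t] fun _ => 0 := fun t ht => by
    filter_upwards [gt_mem_nhds ht] with u hu using hD0 u (le_of_lt hu)
  have hDs : ContDiff ℝ (⊤ : ℕ∞) D := by
    rw [contDiff_iff_contDiffAt]
    intro t
    rcases lt_or_ge t (τ / 2) with ht | ht
    · exact contDiffAt_const.congr_of_eventuallyEq (hD0' t ht)
    · have : t ≠ 0 := by linarith
      exact contDiffAt_const.mul (hχs.contDiffAt.mul (contDiffAt_id.rpow_const_of_ne this))
  have hDdiff : ∀ t, 0 < t → deriv D t = -a * (deriv χ t * t ^ e + χ t * (e * t ^ (e - 1))) := by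
    intro t ht
    have h1 := (hχs.differentiable (by simp) t).hasDerivAt.mul
      (Real.hasDerivAt_rpow_const (x := t) (p := e) (Or.inl ht.ne'))
    exact (h1.const_mul (-a)).deriv
  let w : ℝ → ℝ := fun t => sProfile d τ + ∫ x in τ..t, D x
  have hwD : ∀ t, HasDerivAt w (D t) t := fun t =>
    (intervalIntegral.integral_hasDerivAt_right (hDs.continuous.intervalIntegrable _ _)
      (hDs.continuous.stronglyMeasurableAtFilter _ _) hDs.continuous.continuousAt).const_add _
  have hdw : deriv w = D := funext fun t => (hwD t).deriv
  have hDnp : ∀ t, D t ≤ 0 := fun t => by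
    rcases le_or_gt t (τ / 2) with ht | ht
    · exact (hD0 t ht).le
    · have : 0 < t := by linarith
      have := mul_nonneg (hχnn t) (Real.rpow_nonneg this.le e)
      simp only [D]
      nlinarith
  have hsub : ∀ s t, w t - w s = ∫ x in s..t, D x := fun s t =>
    (intervalIntegral.integral_eq_sub_of_hasDerivAt (fun x _ => hwD x)
      (hDs.continuous.intervalIntegrable _ _)).symm
  have hrad : ∀ t, 0 < t → radialLap d w t = -(4 * a * (t ^ (e + 1) * deriv χ t)) := by
    intro t ht
    rw [radialLap, hdw, hDdiff t ht]
    have h1 : t ^ e = t ^ (e - 1) * t := by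
      rw [← Real.rpow_add_one ht.ne']; congr 1; ring
    have h2 : t ^ (e + 1) = t ^ (e - 1) * t * t := by
      rw [Real.rpow_add_one ht.ne', h1]
    simp only [D]
    rw [h2, h1, show (d : ℝ) = -2 * e by rw [he]; ring]
    ring
  have hrad0 : ∀ t, t < τ / 2 → radialLap d w t = 0 := by
    intro t ht
    rw [radialLap, hdw, hD0 t ht.le, (hD0' t ht).deriv_eq]
    simp
  refine ⟨w, contDiff_infty_iff_deriv.2 ⟨fun t => (hwD t).differentiableAt, hdw ▸ hDs⟩, ?_, ?_,
    ?_, ?_, ?_, ?_, ?_, ?_⟩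
  · intro t ht
    have h : ∫ x in τ..t, D x = sProfile d t - sProfile d τ := by
      refine intervalIntegral.integral_eq_sub_of_hasDerivAt (fun x hx => ?_)
        (hDs.continuous.intervalIntegrable _ _)
      rw [uIcc_of_le ht] at hx
      have := hg x (hτ.trans_le hx.1)
      simpa [D, hχ1 x hx.1] using this
    simp only [w, h]
    ring
  · intro t ht
    have h := hsub 0 t
    rw [intervalIntegral.integral_congr (g := fun _ => 0), intervalIntegral.integral_zero] at h
    · linarith
    · intro x hx
      refine hD0 x (hx.2.trans (sup_le (by positivity) ht))
  · refine antitone_of_deriv_nonpos (fun t => (hwD t).differentiableAt) fun t => ?_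
    rw [hdw]
    exact hDnp t
  · intro t ht
    rw [hdw]
    have h1 := Real.rpow_nonneg ht.le e
    simp only [D, abs_mul, abs_neg, abs_of_pos ha, abs_of_nonneg (hχnn t), abs_of_nonneg h1]
    calc a * (χ t * t ^ e) ≤ a * (1 * t ^ e) := by gcongr; exact hχle t
      _ ≤ _ := by rw [one_mul]; gcongr; exact le_max_left _ _
  · intro t
    rcases lt_or_ge t (τ / 2) with ht | ht
    · exact (hrad0 t ht).le
    · have ht0 : 0 < t := by linarith
      rw [hrad t ht0, neg_nonpos]
      have := hχdnn t
      positivity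
  · intro t
    rcases lt_or_ge t (τ / 2) with ht | ht
    · rw [hrad0 t ht, neg_nonpos]; positivity
    · have ht0 : 0 < t := by linarith
      rw [hrad t ht0, neg_le_neg_iff, hχd]
      have h1 : t ^ (e + 1) ≤ (τ / 2) ^ (e + 1) :=
        Real.rpow_le_rpow_of_nonpos (by positivity) ht (by rw [he]; linarith)
      have h0 : 0 ≤ deriv Real.smoothTransition (2 / τ * t - 1) :=
        Real.smoothTransition.monotone.deriv_nonneg
      have h2 : deriv Real.smoothTransition (2 / τ * t - 1) ≤ C₀ := (le_abs_self _).trans (hC₁ _)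
      calc 4 * a * (t ^ (e + 1) * (2 / τ * deriv Real.smoothTransition (2 / τ * t - 1)))
          ≤ 4 * a * ((τ / 2) ^ (e + 1) * (2 / τ * C₀)) := by gcongr
        _ = 4 * a * C₀ * (1 / 2) ^ e * τ ^ e := by
          rw [Real.rpow_add_one (by positivity), show τ / 2 = 1 / 2 * τ by ring,
            Real.mul_rpow (by norm_num) hτ.le]
          field_simp
        _ ≤ _ := by gcongr; exact le_max_right _ _
  · intro t ht
    rw [hrad t (hτ.trans_le ht), hχd1 t ht]
    simp
  · obtain ⟨c, hc, hcd⟩ := exists_deriv_eq_slope χ (show τ / 2 < τ by linarith)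
      hχs.continuous.continuousOn (hχs.differentiable (by simp)).differentiableOn
    have hc0 : 0 < c := by linarith [hc.1]
    refine ⟨c, hc0, ?_⟩
    rw [hrad c hc0, hcd, hχ1 τ le_rfl, hχ0 _ le_rfl, neg_lt_zero]
    have : 0 < τ - τ / 2 := by linarith
    simp only [sub_zero]
    positivity

lemma norm_sub_sq_eq_quadratic {d : ℕ} (z x : Euc d) :
    ‖x - z‖ ^ 2 = 1 * ‖x‖ ^ 2 + inner ℝ ((-2 : ℝ) • z) x + ‖z‖ ^ 2 := by
  rw [norm_sub_sq_real, inner_smul_left, real_inner_comm x z]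
  simp
  ring

lemma norm_neg_two_smul_sq {d : ℕ} (z : Euc d) : ‖(-2 : ℝ) • z‖ ^ 2 = 4 * ‖z‖ ^ 2 := by
  rw [norm_smul, mul_pow]; norm_num

/-- The squared distance `(‖x‖ ‖z - x / ‖x‖²‖)²` in the reflected term of the Green's function. -/
def kelvinSq {d : ℕ} (z x : Euc d) : ℝ :=
  ‖z‖ ^ 2 * ‖x‖ ^ 2 + inner ℝ ((-2 : ℝ) • z) x + 1

lemma kelvinSq_eq {d : ℕ} (z x : Euc d) :
    kelvinSq z x = ‖x - z‖ ^ 2 + (1 - ‖x‖ ^ 2) * (1 - ‖z‖ ^ 2) := by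
  rw [kelvinSq, norm_sub_sq_eq_quadratic]; ring

lemma one_sub_norm_sq_le_kelvinSq {d : ℕ} {z x : Euc d} (hz : ‖z‖ < 1) (hx : ‖x‖ ≤ 1) :
    (1 - ‖z‖) ^ 2 ≤ kelvinSq z x := by
  have h := real_inner_le_norm z x
  rw [kelvinSq, inner_smul_left]
  simp only [conj_trivial]
  have h1 : ‖z‖ * ‖x‖ ≤ ‖z‖ := mul_le_of_le_one_right (norm_nonneg z) hx
  nlinarith [norm_nonneg z, norm_nonneg x, mul_nonneg (norm_nonneg z) (norm_nonneg x)]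

lemma contDiff_kelvinSq {d : ℕ} (z : Euc d) : ContDiff ℝ (⊤ : ℕ∞) (kelvinSq z) :=
  ((contDiff_const.mul (contDiff_norm_sq ℝ)).add (innerSL ℝ ((-2 : ℝ) • z)).contDiff).add
    contDiff_const

lemma contDiff_norm_sub_sq {d : ℕ} (z : Euc d) :
    ContDiff ℝ (⊤ : ℕ∞) fun x : Euc d => ‖x - z‖ ^ 2 :=
  (contDiff_id.sub contDiff_const).norm_sq ℝ

lemma lap_comp_norm_sub_sq {d : ℕ} {w : ℝ → ℝ} (hw : ContDiff ℝ (⊤ : ℕ∞) w) (z x : Euc d) :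
    lap (fun y => w (‖y - z‖ ^ 2)) x = radialLap d w (‖x - z‖ ^ 2) := by
  rw [lap_comp_quadratic (p := fun y => ‖y - z‖ ^ 2) (norm_sub_sq_eq_quadratic z)
    (by rw [norm_neg_two_smul_sq]; ring) hw, radialLap]
  ring

lemma pd_comp_norm_sub_sq {d : ℕ} {w : ℝ → ℝ} (hw : Differentiable ℝ w) (z x : Euc d)
    (i : Fin d) :
    pd i (fun y => w (‖y - z‖ ^ 2)) x = 2 * deriv w (‖x - z‖ ^ 2) * (x i - z i) := by
  rw [pd_comp_quadratic (p := fun y => ‖y - z‖ ^ 2) i (norm_sub_sq_eq_quadratic z) hw]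
  simp
  ring

lemma lap_comp_kelvinSq {d : ℕ} {w : ℝ → ℝ} (hw : ContDiff ℝ (⊤ : ℕ∞) w) (z x : Euc d) :
    lap (fun y => w (kelvinSq z y)) x = ‖z‖ ^ 2 * radialLap d w (kelvinSq z x) := by
  rw [lap_comp_quadratic (p := kelvinSq z) (fun _ => rfl)
    (by rw [norm_neg_two_smul_sq]; ring) hw, radialLap]

/-- The Green's function of the ball with its pole smoothed out. -/
def truncGreen {d : ℕ} (w : ℝ → ℝ) (z x : Euc d) : ℝ := w (‖x - z‖ ^ 2) - w (kelvinSq z x)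

lemma contDiff_truncGreen {d : ℕ} {w : ℝ → ℝ} (hw : ContDiff ℝ (⊤ : ℕ∞) w) (z : Euc d) :
    ContDiff ℝ (⊤ : ℕ∞) (truncGreen w z) :=
  (hw.comp (contDiff_norm_sub_sq z)).sub (hw.comp (contDiff_kelvinSq z))

lemma lap_truncGreen {d : ℕ} {C τ : ℝ} {w : ℝ → ℝ} (hw : IsTruncatedProfile d C τ w)
    {z x : Euc d} (hz : ‖z‖ < 1) (hx : ‖x‖ ≤ 1) (hτ : τ ≤ (1 - ‖z‖) ^ 2) :
    lap (truncGreen w z) x = radialLap d w (‖x - z‖ ^ 2) := by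
  have h1 : ContDiff ℝ (⊤ : ℕ∞) fun y : Euc d => w (‖y - z‖ ^ 2) :=
    hw.contDiff.comp (contDiff_norm_sub_sq z)
  have h2 : ContDiff ℝ (⊤ : ℕ∞) fun y : Euc d => w (kelvinSq z y) :=
    hw.contDiff.comp (contDiff_kelvinSq z)
  unfold truncGreen
  rw [lap_sub (h1.contDiffAt_two x) (h2.contDiffAt_two x), lap_comp_norm_sub_sq hw.contDiff,
    lap_comp_kelvinSq hw.contDiff,
    hw.radialLap_of_ge _ (hτ.trans (one_sub_norm_sq_le_kelvinSq hz hx))]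
  ring

lemma greenBall_eq {d : ℕ} (x y : Euc d) :
    greenBall d x y = sProfile d (‖x - y‖ ^ 2) - sProfile d (kelvinSq y x) := by
  rw [sProfile_norm_sq, greenBall]
  split_ifs with h
  · subst h
    simp [sProfile, kelvinSq]
  · have hx : ‖x‖ ≠ 0 := norm_ne_zero_iff.2 h
    have h1 : kelvinSq y x = (‖x‖ * ‖y - (‖x‖ ^ 2)⁻¹ • x‖) ^ 2 := by
      rw [mul_pow, norm_sub_sq_real, norm_smul, inner_smul_right, kelvinSq, inner_smul_left]
      simp only [norm_inv, norm_pow, norm_norm, conj_trivial]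
      field_simp
      ring
    rw [h1, sProfile, Real.sqrt_sq (by positivity)]

lemma greenBall_eq_truncGreen {d : ℕ} {C τ : ℝ} {w : ℝ → ℝ} (hw : IsTruncatedProfile d C τ w)
    {y x : Euc d} (hy : ‖y‖ < 1) (hx : ‖x‖ ≤ 1) (hτ : τ ≤ (1 - ‖y‖) ^ 2)
    (hτx : τ ≤ ‖x - y‖ ^ 2) : greenBall d x y = truncGreen w y x := by
  rw [greenBall_eq, truncGreen, hw.eq_of_ge _ hτx,
    hw.eq_of_ge _ (hτ.trans (one_sub_norm_sq_le_kelvinSq hy hx))]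

lemma isHarmonicOn_greenBall {d : ℕ} (hd : 2 ≤ d) {y : Euc d} (hy : ‖y‖ < 1) :
    IsHarmonicOn (fun x => greenBall d x y) (ball 0 1 \ {y}) := by
  obtain ⟨C, -, hC⟩ := exists_isTruncatedProfile hd
  have key : ∀ x ∈ ball (0 : Euc d) 1 \ {y}, ContDiffAt ℝ 2 (fun x => greenBall d x y) x ∧
      lap (fun x => greenBall d x y) x = 0 := by
    rintro x ⟨hx, hxy⟩
    have hpos : 0 < ‖x - y‖ := norm_pos_iff.2 (sub_ne_zero.2 hxy)
    have h1y : 0 < 1 - ‖y‖ := by linarith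
    obtain ⟨w, hw⟩ := hC (min (‖x - y‖ ^ 2 / 2) ((1 - ‖y‖) ^ 2)) (by positivity)
    have heq : (fun x => greenBall d x y) =ᶠ[𝓝 x] truncGreen w y := by
      have hc : ∀ᶠ x' in 𝓝 x, ‖x - y‖ ^ 2 / 2 < ‖x' - y‖ ^ 2 :=
        (contDiff_norm_sub_sq y).continuous.continuousAt.eventually_const_lt (by
          have := pow_pos hpos 2
          linarith)
      filter_upwards [hc, isOpen_ball.mem_nhds hx] with x' h1 h2
      exact greenBall_eq_truncGreen hw hy (mem_ball_zero_iff.1 h2).le (min_le_right _ _)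
        ((min_le_left _ _).trans h1.le)
    refine ⟨((contDiff_truncGreen hw.contDiff y).contDiffAt_two x).congr_of_eventuallyEq heq, ?_⟩
    rw [lap_congr heq, lap_truncGreen hw hy (mem_ball_zero_iff.1 hx).le (min_le_right _ _)]
    refine hw.radialLap_of_ge _ ((min_le_left _ _).trans ?_)
    have := pow_pos hpos 2
    linarith
  exact ⟨fun x hx => (key x hx).1.contDiffWithinAt, fun x hx => (key x hx).2⟩

lemma IsHarmonicOn.sub_const_mul {d : ℕ} {u v : Euc d → ℝ} {U : Set (Euc d)} (hU : IsOpen U)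
    (hu : IsHarmonicOn u U) (hv : IsHarmonicOn v U) (b : ℝ) :
    IsHarmonicOn (fun x => u x - b * v x) U := by
  refine ⟨hu.1.sub (contDiffOn_const.mul hv.1), fun x hx => ?_⟩
  have hvx := hv.1.contDiffAt (hU.mem_nhds hx)
  rw [lap_sub (hu.1.contDiffAt (hU.mem_nhds hx)) (contDiffAt_const.mul hvx), lap_const_mul b hvx,
    hu.2 x hx, hv.2 x hx]
  simp

/-- The indicator of `U` minus a point times a function continuous there is a.e. strongly
measurable. -/
lemma aestronglyMeasurable_indicator_diff {d : ℕ} {u : Euc d → ℝ} {U K : Set (Euc d)}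
    {y : Euc d} (hu : ContinuousOn u (U \ {y})) (hK : IsClosed K) (hKU : K ⊆ U) :
    AEStronglyMeasurable ((K \ {y}).indicator u) volume := by
  have hm : MeasurableSet (K \ {y}) := hK.measurableSet.diff (measurableSet_singleton y)
  rw [aestronglyMeasurable_indicator_iff hm]
  exact (hu.mono (sdiff_subset_sdiff_left hKU)).aestronglyMeasurable hm

lemma exists_bound_on_compact_diff {d : ℕ} {u : Euc d → ℝ} {U K : Set (Euc d)}
    {y : Euc d} (hu : ContinuousOn u (U \ {y})) (hK : IsCompact K) (hKU : K ⊆ U)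
    (hbdd : ∃ ε > 0, ∃ M : ℝ, ∀ x ∈ ball y ε \ {y}, |u x| ≤ M) :
    ∃ M : ℝ, 0 ≤ M ∧ ∀ x, |(K \ {y}).indicator u x| ≤ M := by
  obtain ⟨ε, hε, M, hM⟩ := hbdd
  have hsub : K \ ball y ε ⊆ U \ {y} := fun x hx => ⟨hKU hx.1, fun h => hx.2 (by
    rw [mem_singleton_iff.1 h]; exact mem_ball_self hε)⟩
  obtain ⟨M', hM'⟩ := (hK.diff isOpen_ball).exists_bound_of_continuousOn (hu.mono hsub)
  refine ⟨max 0 (max M M'), le_max_left _ _, fun x => ?_⟩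
  by_cases hx : x ∈ K \ {y}
  · rw [indicator_of_mem hx]
    by_cases hxb : x ∈ ball y ε
    · exact (hM x ⟨hxb, hx.2⟩).trans ((le_max_left _ _).trans (le_max_right _ _))
    · exact (hM' x ⟨hx.1, hxb⟩).trans ((le_max_right _ _).trans (le_max_right _ _))
  · rw [indicator_of_notMem hx]; simp

lemma lap_zero {d : ℕ} (x : Euc d) : lap (0 : Euc d → ℝ) x = 0 := by
  have h0 : ∀ i, pd i (0 : Euc d → ℝ) = 0 := fun i => funext fun x => by
    simp [pd, fderiv_zero]
  rw [lap_eq_sum_pd (u := (0 : Euc d → ℝ)) contDiffAt_const]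
  simp [h0]

lemma lap_eq_zero_of_notMem_tsupport {d : ℕ} {ψ : Euc d → ℝ} {x : Euc d} (hx : x ∉ tsupport ψ) :
    lap ψ x = 0 := by
  rw [lap_congr (notMem_tsupport_iff_eventuallyEq.1 hx), lap_zero]

lemma pd_eq_zero_of_notMem_tsupport {d : ℕ} {ψ : Euc d → ℝ} {x : Euc d} (hx : x ∉ tsupport ψ)
    (i : Fin d) : pd i ψ x = 0 := by
  rw [(pd_congr (notMem_tsupport_iff_eventuallyEq.1 hx)).eq_of_nhds]
  simp [pd, fderiv_zero]

lemma HasCompactSupport.lap {d : ℕ} {ψ : Euc d → ℝ} (hc : HasCompactSupport ψ) :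
    HasCompactSupport (lap ψ) :=
  HasCompactSupport.intro hc fun _ hx => lap_eq_zero_of_notMem_tsupport hx

/-- The pole of a truncated profile has bounded mass, uniformly in the truncation radius. -/
lemma integral_indicator_closedBall_rpow {d : ℕ} (y : Euc d) {τ : ℝ} (hτ : 0 < τ) (c : ℝ) :
    ∫ x, (closedBall y (Real.sqrt τ)).indicator (fun _ => c * τ ^ (-(d : ℝ) / 2)) x =
      volume.real (ball (0 : Euc d) 1) * c := by
  rw [integral_indicator_const _ measurableSet_closedBall, Measure.real,
    Measure.addHaar_closedBall _ _ (Real.sqrt_nonneg τ), ENNReal.toReal_mul,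
    ENNReal.toReal_ofReal (by positivity), finrank_euclideanSpace_fin, Real.sqrt_eq_rpow,
    ← Real.rpow_mul_natCast hτ.le, smul_eq_mul]
  have : τ ^ ((1 : ℝ) / 2 * d) * τ ^ (-(d : ℝ) / 2) = 1 := by
    rw [← Real.rpow_add hτ]; ring_nf; simp
  calc _ = (τ ^ ((1 : ℝ) / 2 * d) * τ ^ (-(d : ℝ) / 2)) *
        ((volume (ball (0 : Euc d) 1)).toReal * c) := by
        ring
    _ = _ := by rw [this, one_mul]; rfl

lemma integrable_indicator_norm_rpow {d : ℕ} (hd : 2 ≤ d) (y : Euc d) (R : ℝ) :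
    Integrable fun x : Euc d =>
      (ball (0 : Euc d) R).indicator (fun x => ‖x‖ ^ (-((d : ℝ) - 1))) (x - y) := by
  have h : IntegrableOn (fun x : Euc d => ‖x‖ ^ (-((d : ℝ) - 1))) (ball 0 R) := by
    refine integrableOn_ball_of_norm_le_rpow (C := 1) (α := (d : ℝ) - 1) ?_ ?_ ?_ ?_
    · rw [finrank_euclideanSpace_fin]; omega
    · rw [finrank_euclideanSpace_fin]; linarith
    · refine Eventually.of_forall fun x => ?_
      rw [one_mul, Real.norm_of_nonneg (by positivity)]
    · exact (measurable_norm.pow_const _).aestronglyMeasurable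
  exact ((integrable_indicator_iff measurableSet_ball).2 h).comp_sub_right y

/-- Multiplying a test function by a truncated profile perturbs its Laplacian by an amount whose
mass is bounded uniformly in the truncation radius. -/
lemma exists_bound_lap_mul_comp {d : ℕ} {C : ℝ} (hC : 0 < C) {ψ : Euc d → ℝ} {y : Euc d}
    (hψ : ContDiff ℝ (⊤ : ℕ∞) ψ) (hc : HasCompactSupport ψ) {R : ℝ}
    (hR : tsupport ψ ⊆ ball y R) :
    ∃ K₁ K₂ : ℝ, ∀ τ w, 0 < τ → IsTruncatedProfile d C τ w → ∀ x, x ≠ y →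
      |lap (fun x => ψ x * w (‖x - y‖ ^ 2)) x - w (‖x - y‖ ^ 2) * lap ψ x| ≤
        (closedBall y (Real.sqrt τ)).indicator (fun _ => K₁ * τ ^ (-(d : ℝ) / 2)) x +
          K₂ * (ball (0 : Euc d) R).indicator (fun x => ‖x‖ ^ (-((d : ℝ) - 1))) (x - y) := by
  obtain ⟨A, hA⟩ := hc.exists_bound_of_continuous hψ.continuous
  have hpc : ∀ i, HasCompactSupport (pd i ψ) := fun i =>
    HasCompactSupport.intro hc fun x hx => pd_eq_zero_of_notMem_tsupport hx i
  choose B hB using fun i => (hpc i).exists_bound_of_continuous (contDiff_pd i hψ).continuous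
  have hA0 : 0 ≤ A := (norm_nonneg _).trans (hA 0)
  have hB0 : ∀ i, 0 ≤ B i := fun i => (norm_nonneg _).trans (hB i 0)
  refine ⟨A * C, 2 * ∑ i, B i * (2 * C), fun τ w hτ hw x hxy => ?_⟩
  have hW : ContDiff ℝ (⊤ : ℕ∞) fun y' : Euc d => w (‖y' - y‖ ^ 2) :=
    hw.contDiff.comp (contDiff_norm_sub_sq y)
  have hr : 0 < ‖x - y‖ := norm_pos_iff.2 (sub_ne_zero.2 hxy)
  rw [lap_mul hψ hW, lap_comp_norm_sub_sq hw.contDiff]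
  have h1 : |ψ x * radialLap d w (‖x - y‖ ^ 2)| ≤
      (closedBall y (Real.sqrt τ)).indicator (fun _ => A * C * τ ^ (-(d : ℝ) / 2)) x := by
    by_cases hx : x ∈ closedBall y (Real.sqrt τ)
    · rw [indicator_of_mem hx, abs_mul, mul_assoc]
      gcongr
      · exact hA x
      · rw [abs_le]
        exact ⟨hw.le_radialLap _, (hw.radialLap_nonpos _).trans (by positivity)⟩
    · rw [indicator_of_notMem hx, hw.radialLap_of_ge]
      · simp
      · rw [mem_closedBall, dist_eq_norm, not_le] at hx
        exact (Real.sqrt_le_left (norm_nonneg _)).1 hx.le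
  have h2 : |2 * ∑ i, pd i ψ x * pd i (fun y' => w (‖y' - y‖ ^ 2)) x| ≤
      (2 * ∑ i, B i * (2 * C)) *
        (ball (0 : Euc d) R).indicator (fun x => ‖x‖ ^ (-((d : ℝ) - 1))) (x - y) := by
    by_cases hx : x ∈ tsupport ψ
    · have hx' : x - y ∈ ball (0 : Euc d) R := by
        rw [mem_ball_zero_iff, ← dist_eq_norm]; exact hR hx
      rw [indicator_of_mem hx', abs_mul, abs_two, mul_assoc, Finset.sum_mul]
      gcongr
      refine (Finset.abs_sum_le_sum_abs _ _).trans (Finset.sum_le_sum fun i _ => ?_)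
      rw [abs_mul, mul_assoc]
      refine mul_le_mul (hB i x) ?_ (abs_nonneg _) (hB0 i)
      rw [pd_comp_norm_sub_sq (hw.contDiff.differentiable (by simp)), abs_mul, abs_mul, abs_two,
        mul_assoc, mul_assoc]
      refine mul_le_mul_of_nonneg_left ?_ zero_le_two
      have h3 := hw.abs_deriv_le (‖x - y‖ ^ 2) (by positivity)
      have h4 : |x i - y i| ≤ ‖x - y‖ := by
        simpa using PiLp.norm_apply_le (x - y) i
      calc _ ≤ C * (‖x - y‖ ^ 2) ^ (-(d : ℝ) / 2) * ‖x - y‖ := by gcongr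
        _ = C * ‖x - y‖ ^ (-((d : ℝ) - 1)) := by
            rw [← Real.rpow_natCast_mul hr.le, mul_assoc, ← Real.rpow_add_one hr.ne']
            congr 2; push_cast; ring
    · simp only [pd_eq_zero_of_notMem_tsupport hx, zero_mul, Finset.sum_const_zero, mul_zero,
        abs_zero]
      refine mul_nonneg ?_ (indicator_nonneg (fun x _ => by positivity) _)
      exact mul_nonneg zero_le_two (Finset.sum_nonneg fun i _ => mul_nonneg (hB0 i) (by positivity))
  calc _ = |ψ x * radialLap d w (‖x - y‖ ^ 2) +
        2 * ∑ i, pd i ψ x * pd i (fun y' => w (‖y' - y‖ ^ 2)) x| := by congr 1; ring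
    _ ≤ _ := (abs_add_le _ _).trans (add_le_add h1 h2)

/-- Isolated singularities near which a harmonic function is bounded are removable (in the weak
sense). -/
lemma integral_mul_lap_eq_zero_of_bounded {d : ℕ} (hd : 2 ≤ d) {u ψ : Euc d → ℝ}
    {U : Set (Euc d)} {y : Euc d} (hU : IsOpen U) (hu : IsHarmonicOn u (U \ {y}))
    (hbdd : ∃ ε > 0, ∃ M : ℝ, ∀ x ∈ ball y ε \ {y}, |u x| ≤ M)
    (hψ : ContDiff ℝ (⊤ : ℕ∞) ψ) (hc : HasCompactSupport ψ) (hsub : tsupport ψ ⊆ U) :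
    ∫ x, u x * lap ψ x = 0 := by
  obtain ⟨C, hC, hw⟩ := exists_isTruncatedProfile hd
  have hUo : IsOpen (U \ {y}) := hU.sdiff isClosed_singleton
  obtain ⟨M, hM0, hM⟩ := exists_bound_on_compact_diff hu.1.continuousOn hc hsub hbdd
  set v : Euc d → ℝ := (tsupport ψ \ {y}).indicator u with hv
  have hvm : AEStronglyMeasurable v volume :=
    aestronglyMeasurable_indicator_diff hu.1.continuousOn (isClosed_tsupport ψ) hsub
  have hvint : ∀ θ : Euc d → ℝ, Continuous θ → HasCompactSupport θ →
      Integrable fun x => v x * θ x := fun θ hθ hθc =>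
    (hθ.integrable_of_hasCompactSupport hθc).bdd_mul hvm (Eventually.of_forall hM)
  have : Nonempty (Fin d) := ⟨⟨0, by omega⟩⟩
  have hne : ∀ᵐ x : Euc d, x ≠ y := by
    simp [ae_iff]
  have huv : ∀ θ : Euc d → ℝ, (∀ x, x ∉ tsupport ψ → θ x = 0) →
      ∫ x, u x * θ x = ∫ x, v x * θ x := fun θ hθ => by
    refine integral_congr_ae (hne.mono fun x hx => ?_)
    by_cases hxK : x ∈ tsupport ψ
    · have : x ∈ tsupport ψ \ {y} := ⟨hxK, hx⟩
      simp only [hv, indicator_of_mem this]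
    · simp [hθ x hxK]
  obtain ⟨R, hR0, hR⟩ : ∃ R, 0 < R ∧ tsupport ψ ⊆ ball y R := by
    obtain ⟨R, hR0, hR⟩ := hc.isBounded.subset_ball_lt 0 y
    exact ⟨R, hR0, hR⟩
  obtain ⟨K₁, K₂, hK⟩ := exists_bound_lap_mul_comp hC (y := y) hψ hc hR
  have hτ : ∀ n : ℕ, (0 : ℝ) < 1 / ((n : ℝ) + 1) := fun n => Nat.one_div_pos_of_nat
  choose w hw using fun n : ℕ => hw _ (hτ n)
  have hWs : ∀ n, ContDiff ℝ (⊤ : ℕ∞) fun x : Euc d => w n (‖x - y‖ ^ 2) := fun n =>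
    (hw n).contDiff.comp (contDiff_norm_sub_sq y)
  have hψW : ∀ n, ContDiff ℝ (⊤ : ℕ∞) fun x => ψ x * w n (‖x - y‖ ^ 2) := fun n =>
    hψ.mul (hWs n)
  have hψWc : ∀ n, HasCompactSupport fun x => ψ x * w n (‖x - y‖ ^ 2) := fun n => hc.mul_right
  have hw0 : Tendsto (fun n => w n 0) atTop atTop := by
    have ht : Tendsto (fun n : ℕ => (1 : ℝ) / ((n : ℝ) + 1)) atTop (𝓝[>] 0) :=
      tendsto_nhdsWithin_iff.2 ⟨tendsto_one_div_add_atTop_nhds_zero_nat, Eventually.of_forall hτ⟩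
    refine tendsto_atTop_mono (fun n => ?_) ((tendsto_sProfile_zero hd).comp ht)
    rw [Function.comp_apply, ← (hw n).eq_of_ge _ le_rfl]
    exact (hw n).antitone (hτ n).le
  have hident : ∀ n, w n 0 * ∫ x, v x * lap ψ x =
      ∫ x, v x * lap (fun x => ψ x * w n (‖x - y‖ ^ 2)) x := by
    intro n
    set φ : Euc d → ℝ := fun x => w n 0 * ψ x - ψ x * w n (‖x - y‖ ^ 2) with hφ
    have hφs : ContDiff ℝ (⊤ : ℕ∞) φ := (contDiff_const.mul hψ).sub (hψW n)
    have hφt : tsupport φ ⊆ tsupport ψ := by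
      refine closure_mono fun x hx => ?_
      contrapose! hx
      simp [hφ, Function.notMem_support.1 hx]
    have hφy : y ∉ tsupport φ := by
      rw [notMem_tsupport_iff_eventuallyEq]
      have : ∀ᶠ x in 𝓝 y, ‖x - y‖ ^ 2 < 1 / ((n : ℝ) + 1) / 2 :=
        (contDiff_norm_sub_sq y).continuous.continuousAt.eventually_lt continuousAt_const
          (by simpa using half_pos (hτ n))
      filter_upwards [this] with x hx
      simp only [hφ, (hw n).eq_of_le _ hx.le, Pi.zero_apply]
      ring
    have h0 := integral_mul_lap_eq_zero hUo hu hφs (hc.mono' (subset_closure.trans hφt))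
      (fun x hx => ⟨hsub (hφt hx), fun h => hφy (mem_singleton_iff.1 h ▸ hx)⟩)
    rw [huv _ fun x hx => lap_eq_zero_of_notMem_tsupport fun h => hx (hφt h)] at h0
    have h1 : ∀ x, v x * lap φ x = w n 0 * (v x * lap ψ x) -
        v x * lap (fun x => ψ x * w n (‖x - y‖ ^ 2)) x := fun x => by
      rw [hφ, lap_sub ((contDiff_const.mul hψ).contDiffAt_two x) ((hψW n).contDiffAt_two x),
        lap_const_mul _ (hψ.contDiffAt_two x)]
      ring
    simp only [h1] at h0
    rw [integral_sub ((hvint _ hψ.lap.continuous hc.lap).const_mul _)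
      (hvint _ (hψW n).lap.continuous (hψWc n).lap), integral_const_mul] at h0
    linarith
  set g : Euc d → ℝ := fun x =>
    (ball (0 : Euc d) R).indicator (fun x => ‖x‖ ^ (-((d : ℝ) - 1))) (x - y) with hg
  set K : ℝ := M * (volume.real (ball (0 : Euc d) 1) * K₁ + K₂ * ∫ x, g x) with hKdef
  have hvWint : ∀ n, Integrable fun x => v x * (w n (‖x - y‖ ^ 2) * lap ψ x) := fun n =>
    hvint _ ((hWs n).continuous.mul hψ.lap.continuous) hc.lap.mul_left
  have hbound : ∀ n, |w n 0 * (∫ x, v x * lap ψ x) -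
      ∫ x, v x * (w n (‖x - y‖ ^ 2) * lap ψ x)| ≤ K := by
    intro n
    have hi1 : Integrable ((closedBall y (Real.sqrt (1 / ((n : ℝ) + 1)))).indicator
        (fun _ => K₁ * (1 / ((n : ℝ) + 1)) ^ (-(d : ℝ) / 2))) :=
      (integrable_indicator_iff measurableSet_closedBall).2 (integrableOn_const
        measure_closedBall_lt_top.ne)
    have hi2 : Integrable g := integrable_indicator_norm_rpow hd y R
    rw [hident, ← integral_sub (hvint _ (hψW n).lap.continuous (hψWc n).lap) (hvWint n),
      hKdef, ← integral_indicator_closedBall_rpow y (hτ n), ← integral_const_mul,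
      ← integral_add hi1 (hi2.const_mul _), ← integral_const_mul, ← Real.norm_eq_abs]
    refine norm_integral_le_of_norm_le ((hi1.add (hi2.const_mul _)).const_mul _) ?_
    filter_upwards [hne] with x hx
    rw [← mul_sub, norm_mul]
    exact mul_le_mul (hM x) (hK _ _ (hτ n) (hw n) x hx) (norm_nonneg _) hM0
  have hlim : Tendsto (fun n => ∫ x, (w n 0)⁻¹ * (v x * (w n (‖x - y‖ ^ 2) * lap ψ x)))
      atTop (𝓝 0) := by
    have hsmall : ∀ r : ℝ, 0 < r → ∀ᶠ n : ℕ in atTop, 1 / ((n : ℝ) + 1) ≤ r := fun r hr =>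
      (tendsto_one_div_add_atTop_nhds_zero_nat.eventually (ge_mem_nhds hr))
    have h0 : ∫ _ : Euc d, (0 : ℝ) = 0 := integral_zero _ _
    suffices h : Tendsto (fun n => ∫ x, (w n 0)⁻¹ * (v x * (w n (‖x - y‖ ^ 2) * lap ψ x))) atTop
        (𝓝 (∫ _ : Euc d, (0 : ℝ))) by rwa [h0] at h
    refine tendsto_integral_filter_of_dominated_convergence
      (fun x => max 1 |sProfile d (R ^ 2)| * (M * |lap ψ x|)) ?_ ?_ ?_ ?_
    · exact Eventually.of_forall fun n => ((hvWint n).const_mul _).aestronglyMeasurable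
    · filter_upwards [hw0.eventually_ge_atTop 1, hsmall (R ^ 2) (by positivity)] with n h1 h2
      refine Eventually.of_forall fun x => ?_
      by_cases hx : x ∈ tsupport ψ
      · have hxR : ‖x - y‖ ≤ R := by
          rw [← dist_eq_norm]; exact (mem_ball.1 (hR hx)).le
        have hlo : sProfile d (R ^ 2) ≤ w n (‖x - y‖ ^ 2) := by
          rw [← (hw n).eq_of_ge _ h2]
          exact (hw n).antitone (by gcongr)
        have hhi : w n (‖x - y‖ ^ 2) ≤ w n 0 := (hw n).antitone (by positivity)
        have hq : |(w n 0)⁻¹ * w n (‖x - y‖ ^ 2)| ≤ max 1 |sProfile d (R ^ 2)| := by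
          have h0 : 0 < w n 0 := by linarith
          rw [abs_mul, abs_inv, abs_of_pos h0, inv_mul_le_iff₀ h0, abs_le]
          have h3 : |sProfile d (R ^ 2)| ≤ max 1 |sProfile d (R ^ 2)| := le_max_right _ _
          have h4 : (1 : ℝ) ≤ max 1 |sProfile d (R ^ 2)| := le_max_left _ _
          have h5 := neg_abs_le (sProfile d (R ^ 2))
          constructor <;> nlinarith
        calc _ = |(w n 0)⁻¹ * w n (‖x - y‖ ^ 2)| * (|v x| * |lap ψ x|) := by
              rw [Real.norm_eq_abs, ← abs_mul, ← abs_mul]; congr 1; ring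
          _ ≤ _ := by gcongr; exact hM x
      · simp [lap_eq_zero_of_notMem_tsupport hx]
    · exact (((hψ.lap.continuous.integrable_of_hasCompactSupport hc.lap).abs).const_mul _).const_mul
        _
    · filter_upwards [hne] with x hx
      have hr : 0 < ‖x - y‖ ^ 2 := by have := sub_ne_zero.2 hx; positivity
      have h1 : Tendsto (fun n => (w n 0)⁻¹ * (v x * (sProfile d (‖x - y‖ ^ 2) * lap ψ x)))
          atTop (𝓝 0) := by
        simpa using hw0.inv_tendsto_atTop.mul_const (v x * (sProfile d (‖x - y‖ ^ 2) * lap ψ x))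
      refine h1.congr' ?_
      filter_upwards [hsmall _ hr] with n hn
      rw [(hw n).eq_of_ge _ hn]
  rw [huv _ fun x hx => lap_eq_zero_of_notMem_tsupport hx]
  have hdiff : Tendsto (fun n => (∫ x, v x * lap ψ x) -
      ∫ x, (w n 0)⁻¹ * (v x * (w n (‖x - y‖ ^ 2) * lap ψ x))) atTop (𝓝 0) := by
    refine squeeze_zero_norm' ?_ (by simpa using hw0.inv_tendsto_atTop.mul_const K)
    filter_upwards [hw0.eventually_ge_atTop 1] with n hn
    have h0 : 0 < w n 0 := by linarith
    rw [integral_const_mul, Real.norm_eq_abs, ← div_eq_inv_mul K, le_div_iff₀ h0]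
    calc _ = |w n 0 * (∫ x, v x * lap ψ x) - ∫ x, v x * (w n (‖x - y‖ ^ 2) * lap ψ x)| := by
          rw [← abs_of_pos h0, ← abs_mul, abs_of_pos h0]; congr 1; field_simp
      _ ≤ K := hbound n
  simpa using hdiff.add hlim
/-- A smooth cutoff equal to `1` where `2 * ε ≤ 1 - ‖x‖ ^ 2` and to `0` where
`1 - ‖x‖ ^ 2 ≤ ε`. -/
def ballCutoff {d : ℕ} (ε : ℝ) (x : Euc d) : ℝ :=
  Real.smoothTransition ((1 - ‖x‖ ^ 2) / ε - 1)

/-- A smooth radial function of bounded mass which equals `1 / ε` where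
`ε ≤ 1 - ‖x‖ ^ 2 ≤ 2 * ε` and lives on `ε / 2 ≤ 1 - ‖x‖ ^ 2 ≤ 3 * ε`. -/
def shell {d : ℕ} (ε : ℝ) (x : Euc d) : ℝ :=
  ε⁻¹ * (Real.smoothTransition (2 * ((1 - ‖x‖ ^ 2) / ε) - 1) *
    Real.smoothTransition (3 - (1 - ‖x‖ ^ 2) / ε))

lemma contDiff_ballCutoff {d : ℕ} (ε : ℝ) : ContDiff ℝ (⊤ : ℕ∞) (ballCutoff (d := d) ε) :=
  contDiff_smoothTransition.comp
    (((contDiff_const.sub (contDiff_norm_sq ℝ)).div_const _).sub contDiff_const)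

lemma contDiff_shell {d : ℕ} (ε : ℝ) : ContDiff ℝ (⊤ : ℕ∞) (shell (d := d) ε) := by
  have h : ContDiff ℝ (⊤ : ℕ∞) fun x : Euc d => (1 - ‖x‖ ^ 2) / ε :=
    (contDiff_const.sub (contDiff_norm_sq ℝ)).div_const _
  exact contDiff_const.mul ((contDiff_smoothTransition.comp
    ((contDiff_const.mul h).sub contDiff_const)).mul
    (contDiff_smoothTransition.comp (contDiff_const.sub h)))

lemma shell_nonneg {d : ℕ} {ε : ℝ} (hε : 0 < ε) (x : Euc d) : 0 ≤ shell ε x :=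
  mul_nonneg (by positivity) (mul_nonneg (Real.smoothTransition.nonneg _)
    (Real.smoothTransition.nonneg _))

lemma shell_le {d : ℕ} {ε : ℝ} (hε : 0 < ε) (x : Euc d) : shell ε x ≤ ε⁻¹ :=
  mul_le_of_le_one_right (by positivity) (mul_le_one₀ (Real.smoothTransition.le_one _)
    (Real.smoothTransition.nonneg _) (Real.smoothTransition.le_one _))

lemma shell_eq_of_mem {d : ℕ} {ε : ℝ} (hε : 0 < ε) {x : Euc d} (h1 : ε ≤ 1 - ‖x‖ ^ 2)
    (h2 : 1 - ‖x‖ ^ 2 ≤ 2 * ε) : shell ε x = ε⁻¹ := by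
  have h3 : 1 ≤ (1 - ‖x‖ ^ 2) / ε := (one_le_div₀ hε).2 h1
  have h4 : (1 - ‖x‖ ^ 2) / ε ≤ 2 := (div_le_iff₀ hε).2 h2
  rw [shell, Real.smoothTransition.one_of_one_le (by linarith),
    Real.smoothTransition.one_of_one_le (by linarith)]
  ring

lemma shell_eq_of_norm_eq {d : ℕ} {ε : ℝ} {x y : Euc d} (h : ‖x‖ = ‖y‖) :
    shell ε x = shell ε y := by
  rw [shell, shell, h]

/-- The closed spherical layer containing the support of `shell ε`. -/
def layer (d : ℕ) (ε : ℝ) : Set (Euc d) := {x | ε / 2 ≤ 1 - ‖x‖ ^ 2 ∧ 1 - ‖x‖ ^ 2 ≤ 3 * ε}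

lemma support_shell_subset {d : ℕ} {ε : ℝ} (hε : 0 < ε) :
    Function.support (shell (d := d) ε) ⊆ layer d ε := by
  intro x hx
  by_contra hxl
  refine hx ?_
  rw [shell]
  rcases not_and_or.1 hxl with h | h
  · rw [Real.smoothTransition.zero_of_nonpos (x := 2 * ((1 - ‖x‖ ^ 2) / ε) - 1)]
    · simp
    · have : (1 - ‖x‖ ^ 2) / ε ≤ 1 / 2 := (div_le_iff₀ hε).2 (by linarith)
      linarith
  · rw [Real.smoothTransition.zero_of_nonpos (x := 3 - (1 - ‖x‖ ^ 2) / ε)]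
    · simp
    · have : 3 ≤ (1 - ‖x‖ ^ 2) / ε := (le_div_iff₀ hε).2 (by linarith)
      linarith

lemma norm_lt_one_of_mem_layer {d : ℕ} {ε : ℝ} (hε : 0 < ε) {x : Euc d} (hx : x ∈ layer d ε) :
    ‖x‖ < 1 := by
  have := hx.1
  nlinarith [norm_nonneg x]

lemma one_sub_le_norm_of_mem_layer {d : ℕ} {ε : ℝ} {x : Euc d} (hε : 0 < ε)
    (hx : x ∈ layer d ε) : 1 - 3 * ε ≤ ‖x‖ := by
  have := hx.2
  nlinarith [norm_nonneg x, norm_lt_one_of_mem_layer hε hx]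

lemma isCompact_layer {d : ℕ} {ε : ℝ} (hε : 0 < ε) : IsCompact (layer d ε) := by
  have hc : Continuous fun x : Euc d => 1 - ‖x‖ ^ 2 := by fun_prop
  refine (isCompact_closedBall (0 : Euc d) 1).of_isClosed_subset
    ((isClosed_le continuous_const hc).inter (isClosed_le hc continuous_const)) fun x hx => ?_
  rw [mem_closedBall_zero_iff]
  exact (norm_lt_one_of_mem_layer hε hx).le

lemma hasCompactSupport_of_support_subset_layer {d : ℕ} {ε : ℝ} (hε : 0 < ε) {f : Euc d → ℝ}
    (hf : Function.support f ⊆ layer d ε) : HasCompactSupport f :=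
  HasCompactSupport.of_support_subset_isCompact (isCompact_layer hε) hf

lemma integral_shell_le {d : ℕ} {ε : ℝ} (hε : 0 < ε) (hε' : 3 * ε < 1) :
    ∫ x : Euc d, shell ε x ≤ 3 * d * volume.real (ball (0 : Euc d) 1) := by
  have hsub : layer d ε ⊆ closedBall 0 1 \ ball 0 (1 - 3 * ε) := fun x hx => by
    rw [Set.mem_sdiff, mem_closedBall_zero_iff, mem_ball_zero_iff, not_lt]
    exact ⟨(norm_lt_one_of_mem_layer hε hx).le, one_sub_le_norm_of_mem_layer hε hx⟩
  set V := volume.real (ball (0 : Euc d) 1) with hV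
  have h0 : volume (closedBall (0 : Euc d) 1 \ ball 0 (1 - 3 * ε)) ≠ ⊤ :=
    (measure_mono sdiff_subset).trans_lt measure_closedBall_lt_top |>.ne
  have hvol : volume.real (closedBall (0 : Euc d) 1 \ ball 0 (1 - 3 * ε)) ≤ 3 * d * ε * V := by
    rw [measureReal_sdiff (ball_subset_closedBall.trans
      (closedBall_subset_closedBall (by linarith))) measurableSet_ball
      measure_closedBall_lt_top.ne, Measure.addHaar_real_closedBall _ _ zero_le_one,
      measureReal_def (s := ball (0 : Euc d) (1 - 3 * ε)),
      Measure.addHaar_ball_of_pos _ _ (by linarith : 0 < 1 - 3 * ε), ENNReal.toReal_mul,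
      ENNReal.toReal_ofReal (pow_nonneg (by linarith) _), finrank_euclideanSpace_fin, one_pow]
    have h1 := one_add_mul_le_pow (a := -(3 * ε)) (by linarith) d
    have h2 : 0 ≤ V := measureReal_nonneg
    rw [← sub_eq_add_neg] at h1
    change 1 * V - (1 - 3 * ε) ^ d * V ≤ _
    nlinarith
  have h_int : Integrable (shell (d := d) ε) :=
    (contDiff_shell ε).continuous.integrable_of_hasCompactSupport
      (hasCompactSupport_of_support_subset_layer hε (support_shell_subset hε))
  calc ∫ x : Euc d, shell ε x
      ≤ ∫ x, (closedBall (0 : Euc d) 1 \ ball 0 (1 - 3 * ε)).indicator (fun _ => ε⁻¹) x := by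
        refine integral_mono h_int ((integrable_indicator_iff
          (measurableSet_closedBall.diff measurableSet_ball)).2 (integrableOn_const h0)) fun x => ?_
        by_cases hx : x ∈ layer d ε
        · rw [indicator_of_mem (hsub hx)]; exact shell_le hε x
        · rw [Function.notMem_support.1 fun h => hx (support_shell_subset hε h)]
          exact indicator_nonneg (fun _ _ => by positivity) _
    _ = volume.real (closedBall (0 : Euc d) 1 \ ball 0 (1 - 3 * ε)) * ε⁻¹ := by
        rw [integral_indicator_const _ (measurableSet_closedBall.diff measurableSet_ball),
          smul_eq_mul]
    _ ≤ 3 * d * ε * V * ε⁻¹ := by gcongr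
    _ = 3 * d * V := by field_simp

lemma exists_bound_lap_ballCutoff_mul {d : ℕ} {φ : Euc d → ℝ} {L : ℝ}
    (hφ : ContDiff ℝ (⊤ : ℕ∞) φ) (hL : ∀ x, ‖x‖ ≤ 1 → |φ x| ≤ L * (1 - ‖x‖ ^ 2)) :
    ∃ C : ℝ, 0 < C ∧ ∀ ε, 0 < ε → ε ≤ 1 → ∀ x,
      |lap (fun x => ballCutoff ε x * φ x) x - ballCutoff ε x * lap φ x| ≤ C * shell ε x := by
  obtain ⟨S, hS, hS1, hS2⟩ := exists_bound_deriv_smoothTransition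
  choose P hP using fun i => (isCompact_closedBall (0 : Euc d) 1).exists_bound_of_continuousOn
    (contDiff_pd i hφ).continuous.continuousOn
  have hP0 : ∀ i, 0 ≤ P i := fun i => (norm_nonneg _).trans (hP i 0 (by simp))
  have hL0 : 0 ≤ L := by simpa using (abs_nonneg _).trans (hL 0 (by simp))
  have hQ : 0 ≤ 2 * ∑ i, 2 * S * P i :=
    mul_nonneg zero_le_two (Finset.sum_nonneg fun i _ => mul_nonneg (by positivity) (hP0 i))
  have hQ' : 0 < L * 2 * (4 * S + 2 * d * S) + 2 * (∑ i, 2 * S * P i) + 1 := by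
    have : 0 ≤ L * 2 * (4 * S + 2 * d * S) := by positivity
    linarith
  refine ⟨L * 2 * (4 * S + 2 * d * S) + 2 * (∑ i, 2 * S * P i) + 1, hQ',
    fun ε hε hε1 x => ?_⟩
  set H : ℝ → ℝ := fun t => Real.smoothTransition ((1 - t) / ε - 1) with hH
  have hHs : ContDiff ℝ (⊤ : ℕ∞) H :=
    contDiff_smoothTransition.comp
      (((contDiff_const.sub contDiff_id).div_const _).sub contDiff_const)
  have hlin : ∀ t, HasDerivAt (fun t : ℝ => (1 - t) / ε - 1) (-ε⁻¹) t := fun t => by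
    simpa [neg_div] using (((hasDerivAt_id t).const_sub 1).div_const ε).sub_const 1
  have hH1 : deriv H = fun t => deriv Real.smoothTransition ((1 - t) / ε - 1) * (-ε⁻¹) :=
    funext fun t => ((contDiff_smoothTransition.differentiable (by simp) _).hasDerivAt.comp t
      (hlin t)).deriv
  have hH2 : deriv (deriv H) =
      fun t => deriv (deriv Real.smoothTransition) ((1 - t) / ε - 1) * (-ε⁻¹) * (-ε⁻¹) := by
    rw [hH1]
    exact funext fun t => ((((contDiff_deriv contDiff_smoothTransition).differentiable
      (by simp) _).hasDerivAt.comp t (hlin t)).mul_const _).deriv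
  have hη : ∀ x : Euc d, ballCutoff ε x = H (‖x - 0‖ ^ 2) := fun x => by simp [hH, ballCutoff]
  have hlap : lap (fun x => ballCutoff ε x * φ x) x - ballCutoff ε x * lap φ x =
      φ x * radialLap d H (‖x‖ ^ 2) + 2 * ∑ i, 2 * deriv H (‖x‖ ^ 2) * x i * pd i φ x := by
    rw [lap_mul (contDiff_ballCutoff ε) hφ, funext hη, lap_comp_norm_sub_sq hHs]
    simp only [pd_comp_norm_sub_sq (hHs.differentiable (by simp))]
    simp
    ring
  rw [hlap]
  by_cases hx : ε ≤ 1 - ‖x‖ ^ 2 ∧ 1 - ‖x‖ ^ 2 ≤ 2 * ε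
  · have hx1 : ‖x‖ ≤ 1 := by nlinarith [norm_nonneg x, hx.1]
    have hi : ∀ i, |x i| ≤ 1 := fun i => (PiLp.norm_apply_le x i).trans hx1
    rw [shell_eq_of_mem hε hx.1 hx.2]
    have hd1 : |deriv H (‖x‖ ^ 2)| ≤ S * ε⁻¹ := by
      rw [hH1]
      simp only [abs_mul, abs_neg, abs_of_pos (inv_pos.2 hε)]
      gcongr
      exact hS1 _
    have hd2 : |deriv (deriv H) (‖x‖ ^ 2)| ≤ S * ε⁻¹ * ε⁻¹ := by
      rw [hH2]
      simp only [abs_mul, abs_neg, abs_of_pos (inv_pos.2 hε)]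
      gcongr
      exact hS2 _
    have hε2 : ε⁻¹ ≤ ε⁻¹ * ε⁻¹ := le_mul_of_one_le_left (by positivity) ((one_le_inv₀ hε).2 hε1)
    have hr : |radialLap d H (‖x‖ ^ 2)| ≤ (4 * S + 2 * d * S) * (ε⁻¹ * ε⁻¹) := by
      have hx2 : ‖x‖ ^ 2 ≤ 1 := by linarith [hx.1]
      calc _ ≤ |4 * ‖x‖ ^ 2 * deriv (deriv H) (‖x‖ ^ 2)| + |2 * d * deriv H (‖x‖ ^ 2)| :=
            abs_add_le _ _
        _ = 4 * ‖x‖ ^ 2 * |deriv (deriv H) (‖x‖ ^ 2)| + 2 * d * |deriv H (‖x‖ ^ 2)| := by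
            rw [abs_mul (4 * ‖x‖ ^ 2), abs_mul (2 * (d : ℝ)),
              abs_of_nonneg (by positivity : 0 ≤ 4 * ‖x‖ ^ 2),
              abs_of_nonneg (by positivity : (0 : ℝ) ≤ 2 * d)]
        _ ≤ 4 * 1 * (S * ε⁻¹ * ε⁻¹) + 2 * d * (S * (ε⁻¹ * ε⁻¹)) := by
            gcongr
            exact hd1.trans (by gcongr)
        _ = _ := by ring
    have h1 : |φ x * radialLap d H (‖x‖ ^ 2)| ≤ L * 2 * (4 * S + 2 * d * S) * ε⁻¹ := by
      rw [abs_mul]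
      calc _ ≤ (L * (2 * ε)) * ((4 * S + 2 * d * S) * (ε⁻¹ * ε⁻¹)) := by
            gcongr
            exact (hL x hx1).trans (by gcongr; exact hx.2)
        _ = _ := by field_simp
    have h2 : |2 * ∑ i, 2 * deriv H (‖x‖ ^ 2) * x i * pd i φ x| ≤
        (2 * ∑ i, 2 * S * P i) * ε⁻¹ := by
      rw [abs_mul, abs_two, mul_assoc, Finset.sum_mul]
      gcongr
      refine (Finset.abs_sum_le_sum_abs _ _).trans (Finset.sum_le_sum fun i _ => ?_)
      rw [abs_mul, abs_mul, abs_mul, abs_two]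
      calc _ ≤ 2 * (S * ε⁻¹) * 1 * P i := by
            gcongr
            · exact hi i
            · exact hP i x (by simpa using hx1)
        _ = _ := by ring
    refine ((abs_add_le _ _).trans (add_le_add h1 h2)).trans ?_
    rw [← add_mul]
    exact mul_le_mul_of_nonneg_right (by linarith) (by positivity)
  · have h0 : deriv H (‖x‖ ^ 2) = 0 ∧ deriv (deriv H) (‖x‖ ^ 2) = 0 := by
      have hev : H =ᶠ[𝓝 (‖x‖ ^ 2)] fun _ => H (‖x‖ ^ 2) := by
        rcases not_and_or.1 hx with h | h
        · have h' : ∀ t, 1 - t < ε → H t = 0 := fun t ht =>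
            Real.smoothTransition.zero_of_nonpos (by
              rw [sub_nonpos]; exact (div_le_one hε).2 ht.le)
          filter_upwards [(continuous_const.sub continuous_id).continuousAt.eventually_lt
            continuousAt_const (not_le.1 h)] with t ht
          rw [h' t ht, h' _ (not_le.1 h)]
        · have h' : ∀ t, 2 * ε < 1 - t → H t = 1 := fun t ht =>
            Real.smoothTransition.one_of_one_le (by
              rw [le_sub_iff_add_le]; exact (le_div_iff₀ hε).2 (by linarith))
          filter_upwards [continuousAt_const.eventually_lt
            (continuous_const.sub continuous_id).continuousAt (not_le.1 h)] with t ht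
          rw [h' t ht, h' _ (not_le.1 h)]
      refine ⟨by rw [hev.deriv_eq]; simp, ?_⟩
      rw [hev.deriv.deriv_eq]
      simp
    rw [radialLap, h0.1, h0.2]
    simp only [mul_zero, add_zero, zero_mul, Finset.sum_const_zero, abs_zero]
    exact mul_nonneg hQ'.le (shell_nonneg hε x)

lemma exists_bound_truncGreen {d : ℕ} {w : ℝ → ℝ} (hw : ContDiff ℝ (⊤ : ℕ∞) w) {z : Euc d}
    (hz : ‖z‖ < 1) :
    ∃ L : ℝ, 0 ≤ L ∧ ∀ x : Euc d, ‖x‖ ≤ 1 → |truncGreen w z x| ≤ L * (1 - ‖x‖ ^ 2) := by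
  obtain ⟨L, hL⟩ := (isCompact_Icc (a := (0 : ℝ)) (b := 5)).exists_bound_of_continuousOn
    (contDiff_deriv hw).continuous.continuousOn
  have hL0 : 0 ≤ L := (norm_nonneg _).trans (hL 0 (by norm_num))
  refine ⟨L, hL0, fun x hx => ?_⟩
  have h1 : ‖x - z‖ ≤ 2 := (norm_sub_le x z).trans (by linarith)
  have hx2 : ‖x‖ ^ 2 ≤ 1 := pow_le_one₀ (norm_nonneg x) hx
  have hz2 : ‖z‖ ^ 2 ≤ 1 := pow_le_one₀ (norm_nonneg z) hz.le
  have h2 : 0 ≤ (1 - ‖x‖ ^ 2) * (1 - ‖z‖ ^ 2) :=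
    mul_nonneg (by linarith) (by linarith)
  have h3 : (1 - ‖x‖ ^ 2) * (1 - ‖z‖ ^ 2) ≤ 1 - ‖x‖ ^ 2 :=
    mul_le_of_le_one_right (by linarith) (by linarith [sq_nonneg ‖z‖])
  have h4 : ‖x - z‖ ^ 2 ≤ 4 := by nlinarith [norm_nonneg (x - z)]
  have h5 := (convex_Icc (0 : ℝ) 5).norm_image_sub_le_of_norm_deriv_le
    (fun t _ => hw.differentiable (by simp) t) hL
    (x := kelvinSq z x) (y := ‖x - z‖ ^ 2)
    (by rw [kelvinSq_eq]; constructor <;> nlinarith [sq_nonneg ‖x - z‖, sq_nonneg ‖x‖])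
    ⟨by positivity, by linarith⟩
  refine h5.trans ?_
  rw [kelvinSq_eq, sub_add_cancel_left, norm_neg, Real.norm_of_nonneg h2]
  gcongr
/-- Zero boundary values in the averaged sense. -/
def VanishesAtBoundary {d : ℕ} (k : Euc d → ℝ) : Prop :=
  ∀ f : ℕ → Euc d → ℝ, (∀ n, IsTestFun (f n)) → (∀ n x, 0 ≤ f n x) →
    (∃ C : ℝ, ∀ n, ∫ x, f n x ≤ C) →
    Tendsto (fun n => Metric.infDist (0 : Euc d) (tsupport (f n))) atTop (𝓝 1) →
    (∃ C : ℝ, ∀ (n : ℕ) (x y' : Euc d), ‖x‖ = ‖y'‖ → ‖x‖ < 1 → f n x ≤ C * f n y') →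
    Tendsto (fun n => ∫ x in ball (0 : Euc d) 1, k x * f n x) atTop (𝓝 0)

lemma exists_shell_pos {d : ℕ} (hd : 0 < d) {ε : ℝ} (hε : 0 < ε) (hε' : 3 * ε < 1) :
    ∃ x : Euc d, 0 < shell ε x := by
  have h : 0 ≤ 1 - 3 / 2 * ε := by linarith
  refine ⟨EuclideanSpace.single ⟨0, hd⟩ (Real.sqrt (1 - 3 / 2 * ε)), ?_⟩
  have hn : ‖(EuclideanSpace.single ⟨0, hd⟩ (Real.sqrt (1 - 3 / 2 * ε)) : Euc d)‖ ^ 2 =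
      1 - 3 / 2 * ε := by
    rw [PiLp.norm_single, Real.norm_of_nonneg (Real.sqrt_nonneg _), Real.sq_sqrt h]
  rw [shell_eq_of_mem hε (by rw [hn]; linarith) (by rw [hn]; linarith)]
  positivity

lemma VanishesAtBoundary.tendsto_of_comparable {d : ℕ} (hd : 0 < d) {k : Euc d → ℝ}
    (hk : VanishesAtBoundary k) {ε : ℕ → ℝ} (hε : ∀ n, 0 < ε n) (hε' : ∀ n, 3 * ε n < 1)
    (hlim : Tendsto ε atTop (𝓝 0)) {f : ℕ → Euc d → ℝ} {C : ℝ} (hC : 0 < C)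
    (hf : ∀ n, ContDiff ℝ (⊤ : ℕ∞) (f n)) (hlo : ∀ n x, C * shell (ε n) x ≤ f n x)
    (hhi : ∀ n x, f n x ≤ 3 * C * shell (ε n) x) :
    Tendsto (fun n => ∫ x in ball (0 : Euc d) 1, k x * f n x) atTop (𝓝 0) := by
  have hnn : ∀ n x, 0 ≤ f n x := fun n x =>
    (mul_nonneg hC.le (shell_nonneg (hε n) x)).trans (hlo n x)
  have hsupp : ∀ n, Function.support (f n) ⊆ layer d (ε n) := fun n x hx => by
    refine support_shell_subset (hε n) fun h0 => hx ?_
    have := hhi n x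
    rw [h0, mul_zero] at this
    exact this.antisymm (hnn n x)
  have htsupp : ∀ n, tsupport (f n) ⊆ layer d (ε n) := fun n =>
    closure_minimal (hsupp n) (isCompact_layer (hε n)).isClosed
  have hcs : ∀ n, HasCompactSupport (f n) := fun n =>
    hasCompactSupport_of_support_subset_layer (hε n) (hsupp n)
  have hne : ∀ n, ∃ x, x ∈ tsupport (f n) := fun n => by
    obtain ⟨x, hx⟩ := exists_shell_pos hd (hε n) (hε' n)
    exact ⟨x, subset_tsupport _ ((mul_pos hC hx).trans_le (hlo n x)).ne'⟩
  refine hk f (fun n => ⟨hf n, hcs n⟩) hnn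
    ⟨3 * C * (3 * d * volume.real (ball (0 : Euc d) 1)), fun n => ?_⟩ ?_
    ⟨3, fun n x y' hxy _ => ?_⟩
  · have h_int : Integrable (shell (d := d) (ε n)) :=
      (contDiff_shell (ε n)).continuous.integrable_of_hasCompactSupport
        (hasCompactSupport_of_support_subset_layer (hε n) (support_shell_subset (hε n)))
    calc ∫ x, f n x ≤ ∫ x, 3 * C * shell (ε n) x :=
          integral_mono ((hf n).continuous.integrable_of_hasCompactSupport (hcs n))
            (h_int.const_mul _) (hhi n)
      _ ≤ _ := by
          rw [integral_const_mul]
          exact mul_le_mul_of_nonneg_left (integral_shell_le (hε n) (hε' n)) (by positivity)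
  · have hlim' : Tendsto (fun n => 1 - 3 * ε n) atTop (𝓝 1) := by
      simpa using (hlim.const_mul 3).const_sub 1
    refine tendsto_of_tendsto_of_tendsto_of_le_of_le hlim' tendsto_const_nhds
      (fun n => ?_) fun n => ?_
    · refine (le_infDist (hne n)).2 fun x hx => ?_
      rw [dist_zero_left]
      exact one_sub_le_norm_of_mem_layer (hε n) (htsupp n hx)
    · obtain ⟨x, hx⟩ := hne n
      refine (infDist_le_dist_of_mem hx).trans ?_
      rw [dist_zero_left]
      exact (norm_lt_one_of_mem_layer (hε n) (htsupp n hx)).le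
  · calc f n x ≤ 3 * C * shell (ε n) x := hhi n x
      _ = 3 * (C * shell (ε n) y') := by rw [shell_eq_of_norm_eq hxy]; ring
      _ ≤ 3 * f n y' := by gcongr; exact hlo n y'

lemma integrable_mul_of_support_subset {d : ℕ} {u f : Euc d → ℝ} {K : Set (Euc d)}
    (hK : IsCompact K) (hu : ContinuousOn u K) (hf : Continuous f)
    (hsupp : Function.support f ⊆ K) : Integrable fun x => u x * f x :=
  (integrableOn_iff_integrable_of_support_subset
    ((Function.support_mul_subset_right u f).trans hsupp)).1
    ((hu.mul hf.continuousOn).integrableOn_compact hK)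

lemma support_subset_layer_of_abs_le {d : ℕ} {ε C : ℝ} (hε : 0 < ε) {g : Euc d → ℝ}
    (hg : ∀ x, |g x| ≤ C * shell ε x) : Function.support g ⊆ layer d ε := fun x hx => by
  refine support_shell_subset hε fun h0 => hx ?_
  have := hg x
  rw [h0, mul_zero] at this
  exact abs_nonpos_iff.1 this

lemma VanishesAtBoundary.tendsto_of_abs_le {d : ℕ} (hd : 0 < d) {k : Euc d → ℝ} {U : Set (Euc d)}
    (hk : VanishesAtBoundary k) (hkU : ContinuousOn k U) {ε : ℕ → ℝ} (hε : ∀ n, 0 < ε n)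
    (hε' : ∀ n, 3 * ε n < 1) (hlim : Tendsto ε atTop (𝓝 0)) (hU : ∀ n, layer d (ε n) ⊆ U)
    {g : ℕ → Euc d → ℝ} {C : ℝ} (hC : 0 < C) (hg : ∀ n, ContDiff ℝ (⊤ : ℕ∞) (g n))
    (hgC : ∀ n x, |g n x| ≤ C * shell (ε n) x) :
    Tendsto (fun n => ∫ x in ball (0 : Euc d) 1, k x * g n x) atTop (𝓝 0) := by
  have hs : ∀ n, ContDiff ℝ (⊤ : ℕ∞) fun x : Euc d => 2 * C * shell (ε n) x := fun n =>
    contDiff_const.mul (contDiff_shell (ε n))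
  have h1 := hk.tendsto_of_comparable hd hε hε' hlim hC (fun n => (hs n).add (hg n))
    (fun n x => by linarith [neg_le_of_abs_le (hgC n x)])
    (fun n x => by linarith [le_of_abs_le (hgC n x)])
  have h2 := hk.tendsto_of_comparable hd hε hε' hlim hC hs
    (fun n x => by nlinarith [shell_nonneg (hε n) x])
    (fun n x => by nlinarith [shell_nonneg (hε n) x])
  have h3 := h1.sub h2
  rw [sub_zero] at h3
  refine h3.congr fun n => ?_
  have hi1 := integrable_mul_of_support_subset (isCompact_layer (hε n)) (hkU.mono (hU n))
    (hs n).continuous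
    ((Function.support_mul_subset_right _ _).trans (support_shell_subset (hε n)))
  have hi2 := integrable_mul_of_support_subset (isCompact_layer (hε n)) (hkU.mono (hU n))
    (hg n).continuous (support_subset_layer_of_abs_le (hε n) (hgC n))
  simp only [mul_add]
  rw [integral_add hi1.integrableOn hi2.integrableOn, add_sub_cancel_left]

/-- The Green's function with pole at an interior point has zero boundary values. -/
lemma tendsto_integral_greenBall_mul {d : ℕ} (hd : 2 ≤ d) {y : Euc d} (hy : ‖y‖ < 1)
    {ε : ℕ → ℝ} (hε : ∀ n, 0 < ε n) (hε' : ∀ n, 3 * ε n < 1) (hlim : Tendsto ε atTop (𝓝 0))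
    {τ : ℝ} (hτ0 : 0 < τ) (hτ : τ ≤ (1 - ‖y‖) ^ 2)
    (hU : ∀ n, ∀ x ∈ layer d (ε n), τ ≤ ‖x - y‖ ^ 2)
    {g : ℕ → Euc d → ℝ} {C : ℝ} (hC : 0 ≤ C) (hgC : ∀ n x, |g n x| ≤ C * shell (ε n) x) :
    Tendsto (fun n => ∫ x in ball (0 : Euc d) 1, greenBall d x y * g n x) atTop (𝓝 0) := by
  obtain ⟨c, -, hw⟩ := exists_isTruncatedProfile hd
  obtain ⟨w, hw⟩ := hw τ hτ0
  obtain ⟨L, hL0, hL⟩ := exists_bound_truncGreen hw.contDiff hy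
  set V := volume.real (ball (0 : Euc d) 1)
  refine squeeze_zero_norm (a := fun n => L * (3 * ε n) * C * (3 * d * V)) (fun n => ?_)
    (by simpa using (((hlim.const_mul 3).const_mul L).mul_const C).mul_const (3 * d * V))
  have h_int : Integrable (shell (d := d) (ε n)) :=
    (contDiff_shell (ε n)).continuous.integrable_of_hasCompactSupport
      (hasCompactSupport_of_support_subset_layer (hε n) (support_shell_subset (hε n)))
  have hε0 := (hε n).le
  have hpt : ∀ x, ‖greenBall d x y * g n x‖ ≤ L * (3 * ε n) * C * shell (ε n) x := fun x => by
    by_cases hx : x ∈ layer d (ε n)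
    · have hx1 := (norm_lt_one_of_mem_layer (hε n) hx).le
      rw [norm_mul, mul_assoc _ C, greenBall_eq_truncGreen hw hy hx1 hτ (hU n x hx)]
      gcongr
      · exact (hL x hx1).trans (by gcongr; exact hx.2)
      · exact hgC n x
    · rw [Function.notMem_support.1 fun h => hx (support_subset_layer_of_abs_le (hε n) (hgC n) h),
        mul_zero, norm_zero]
      exact mul_nonneg (by positivity) (shell_nonneg (hε n) x)
  calc _ ≤ ∫ x in ball (0 : Euc d) 1, L * (3 * ε n) * C * shell (ε n) x :=
        norm_integral_le_of_norm_le (h_int.const_mul _).integrableOn (Eventually.of_forall hpt)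
    _ ≤ ∫ x, L * (3 * ε n) * C * shell (ε n) x :=
        setIntegral_le_integral (h_int.const_mul _) (Eventually.of_forall fun x =>
          mul_nonneg (by positivity) (shell_nonneg (hε n) x))
    _ ≤ _ := by
        rw [integral_const_mul]
        exact mul_le_mul_of_nonneg_left (integral_shell_le (hε n) (hε' n)) (by positivity)

lemma exists_bound_sub_greenBall {d : ℕ} (hd : 2 ≤ d) {y : Euc d} (hy : ‖y‖ < 1) {b : ℝ}
    {k : Euc d → ℝ}
    (hbdd : ∃ ε > 0, ∃ M : ℝ, ∀ x ∈ ball y ε \ {y}, |k x - b * sFun d ‖x - y‖| ≤ M) :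
    ∃ ε > 0, ∃ M : ℝ, ∀ x ∈ ball y ε \ {y}, |k x - b * greenBall d x y| ≤ M := by
  obtain ⟨ε, hε, M, hM⟩ := hbdd
  have hy' : 0 < 1 - ‖y‖ := sub_pos.2 hy
  obtain ⟨c, -, hw⟩ := exists_isTruncatedProfile hd
  obtain ⟨w, hw⟩ := hw ((1 - ‖y‖) ^ 2) (by positivity)
  obtain ⟨M', hM'⟩ := (isCompact_closedBall (0 : Euc d) 1).exists_bound_of_continuousOn
    (hw.contDiff.comp (contDiff_kelvinSq y)).continuous.continuousOn
  refine ⟨min ε (1 - ‖y‖), lt_min hε hy', M + |b| * M', fun x hx => ?_⟩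
  have hx1 : ‖x‖ ≤ 1 := by
    have h1 : ‖x - y‖ < 1 - ‖y‖ := by
      rw [← dist_eq_norm]; exact (mem_ball.1 hx.1).trans_le (min_le_right _ _)
    have h2 := norm_add_le (x - y) y
    rw [sub_add_cancel] at h2
    linarith
  have hk : |b * sProfile d (kelvinSq y x)| ≤ |b| * M' := by
    rw [abs_mul, ← hw.eq_of_ge _ (one_sub_norm_sq_le_kelvinSq hy hx1)]
    gcongr
    exact hM' x (by simpa using hx1)
  calc |k x - b * greenBall d x y|
      = |(k x - b * sFun d ‖x - y‖) + b * sProfile d (kelvinSq y x)| := by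
        rw [greenBall_eq, sProfile_norm_sq]; congr 1; ring
    _ ≤ _ := (abs_add_le _ _).trans (add_le_add
        (hM x ⟨ball_subset_ball (min_le_left _ _) hx.1, hx.2⟩) hk)

lemma exists_pos_forall_lt_one_sub_norm_sq {d : ℕ} {K : Set (Euc d)} (hK : IsCompact K)
    (hsub : K ⊆ ball 0 1) : ∃ e : ℝ, 0 < e ∧ 3 * e < 1 ∧ ∀ x ∈ K, 3 * e < 1 - ‖x‖ ^ 2 := by
  obtain ⟨a, ha, haK⟩ := hK.exists_forall_le' (f := fun x : Euc d => 1 - ‖x‖ ^ 2) (a := 0)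
    (by fun_prop) fun x hx => by
      have := mem_ball_zero_iff.1 (hsub hx)
      nlinarith [norm_nonneg x]
  have h1 := min_le_left a 1
  have h2 := min_le_right a 1
  have h3 : 0 < min a 1 := lt_min ha one_pos
  exact ⟨min a 1 / 6, by positivity, by linarith, fun x hx => by linarith [haK x hx]⟩

lemma tsupport_ballCutoff_mul_subset {d : ℕ} {ε : ℝ} (hε : 0 < ε) (φ : Euc d → ℝ) :
    tsupport (fun x => ballCutoff ε x * φ x) ⊆ {x | ε ≤ 1 - ‖x‖ ^ 2} := by
  refine closure_minimal (fun x hx => ?_) (isClosed_le continuous_const (by fun_prop))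
  by_contra h
  refine hx ?_
  have : (1 - ‖x‖ ^ 2) / ε ≤ 1 := (div_le_one hε).2 (not_le.1 h).le
  simp only [ballCutoff, Real.smoothTransition.zero_of_nonpos (sub_nonpos.2 this), zero_mul]

lemma ballCutoff_mul_lap_truncGreen {d : ℕ} {C τ : ℝ} {w : ℝ → ℝ}
    (hw : IsTruncatedProfile d C τ w) {z : Euc d} (hz : ‖z‖ < 1) (hτ : τ ≤ (1 - ‖z‖) ^ 2)
    {ε : ℝ} (hε : 0 < ε) (hsub : ∀ x ∈ closedBall z (Real.sqrt τ), 2 * ε ≤ 1 - ‖x‖ ^ 2)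
    (x : Euc d) :
    ballCutoff ε x * lap (truncGreen w z) x = radialLap d w (‖x - z‖ ^ 2) := by
  by_cases hx : x ∈ closedBall z (Real.sqrt τ)
  · have h1 := hsub x hx
    have h2 : 2 ≤ (1 - ‖x‖ ^ 2) / ε := (le_div_iff₀ hε).2 h1
    rw [lap_truncGreen hw hz (by nlinarith [norm_nonneg x]) hτ, ballCutoff,
      Real.smoothTransition.one_of_one_le (by linarith), one_mul]
  · have h1 : radialLap d w (‖x - z‖ ^ 2) = 0 := by
      refine hw.radialLap_of_ge _ ?_
      rw [mem_closedBall, dist_eq_norm, not_le] at hx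
      exact (Real.sqrt_le_left (norm_nonneg _)).1 hx.le
    rw [h1]
    rcases le_or_gt ‖x‖ 1 with hx1 | hx1
    · rw [lap_truncGreen hw hz hx1 hτ, h1, mul_zero]
    · have h2 : (1 - ‖x‖ ^ 2) / ε ≤ 1 := (div_le_one hε).2 (by nlinarith)
      rw [ballCutoff, Real.smoothTransition.zero_of_nonpos (sub_nonpos.2 h2), zero_mul]

lemma continuous_radialLap_norm_sub_sq {d : ℕ} {w : ℝ → ℝ} (hw : ContDiff ℝ (⊤ : ℕ∞) w)
    (z : Euc d) : Continuous fun x : Euc d => radialLap d w (‖x - z‖ ^ 2) := by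
  have h1 := (contDiff_deriv hw).continuous
  have h2 := (contDiff_deriv (contDiff_deriv hw)).continuous
  unfold radialLap
  fun_prop

lemma support_radialLap_norm_sub_sq_subset {d : ℕ} {C τ : ℝ} {w : ℝ → ℝ}
    (hw : IsTruncatedProfile d C τ w) (z : Euc d) :
    Function.support (fun x : Euc d => radialLap d w (‖x - z‖ ^ 2)) ⊆
      closedBall z (Real.sqrt τ) := fun x hx => by
  rw [mem_closedBall, dist_eq_norm]
  exact Real.le_sqrt_of_sq_le (not_lt.1 fun h => hx (hw.radialLap_of_ge _ h.le))

/-- The difference of `k` and a multiple of the Green's function has vanishing weighted averages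
around every point other than the pole. -/
lemma integral_sub_greenBall_mul_radialLap {d : ℕ} (hd : 2 ≤ d) {y : Euc d} (hy : ‖y‖ < 1) {b : ℝ}
    {k : Euc d → ℝ} (hharm : IsHarmonicOn k (ball (0 : Euc d) 1 \ {y}))
    (hbdd : ∃ ε > 0, ∃ M : ℝ, ∀ x ∈ ball y ε \ {y}, |k x - b * sFun d ‖x - y‖| ≤ M)
    (hk : VanishesAtBoundary k) {z : Euc d} (hz : ‖z‖ < 1) {C τ : ℝ} {w : ℝ → ℝ}
    (hw : IsTruncatedProfile d C τ w) (hτ : τ ≤ (1 - ‖z‖) ^ 2)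
    (hsub : closedBall z (Real.sqrt τ) ⊆ ball 0 1 \ {y}) :
    ∫ x, (k x - b * greenBall d x y) * radialLap d w (‖x - z‖ ^ 2) = 0 := by
  set G : Euc d → ℝ := fun x => greenBall d x y with hG
  set h : Euc d → ℝ := fun x => k x - b * G x with hh
  have hUo : IsOpen (ball (0 : Euc d) 1 \ {y}) := isOpen_ball.sdiff isClosed_singleton
  have hGharm : IsHarmonicOn G (ball (0 : Euc d) 1 \ {y}) := isHarmonicOn_greenBall hd hy
  have hhharm : IsHarmonicOn h (ball (0 : Euc d) 1 \ {y}) := hharm.sub_const_mul hUo hGharm b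
  set r := (1 - ‖y‖) / 2 with hr
  have hr0 : 0 < r := by rw [hr]; linarith
  have hyr : closedBall y r ⊆ ball 0 1 := closedBall_subset_ball' (by
    rw [dist_zero_right, hr]; linarith)
  obtain ⟨e, he0, he1, heK⟩ := exists_pos_forall_lt_one_sub_norm_sq
    ((isCompact_closedBall z (Real.sqrt τ)).union (isCompact_closedBall y r))
    (union_subset (hsub.trans sdiff_subset) hyr)
  set ε : ℕ → ℝ := fun n => e * (1 / ((n : ℝ) + 1)) with hεdef
  have hε : ∀ n, 0 < ε n := fun n => mul_pos he0 Nat.one_div_pos_of_nat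
  have hεe : ∀ n, ε n ≤ e := fun n => mul_le_of_le_one_right he0.le (by
    rw [div_le_one (by positivity)]; linarith [(Nat.cast_nonneg n : (0 : ℝ) ≤ n)])
  have hε' : ∀ n, 3 * ε n < 1 := fun n => by linarith [hεe n]
  have hlim : Tendsto ε atTop (𝓝 0) := by
    have h := (tendsto_one_div_add_atTop_nhds_zero_nat (𝕜 := ℝ)).const_mul e
    rwa [mul_zero] at h
  have hlayer : ∀ n, ∀ x ∈ layer d (ε n), r ^ 2 ≤ ‖x - y‖ ^ 2 := fun n x hx => by
    have hxr : x ∉ closedBall y r := fun hxr => by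
      linarith [heK x (Or.inr hxr), hx.2, hεe n]
    rw [mem_closedBall, dist_eq_norm, not_le] at hxr
    gcongr
  have hlayerU : ∀ n, layer d (ε n) ⊆ ball 0 1 \ {y} := fun n x hx =>
    ⟨mem_ball_zero_iff.2 (norm_lt_one_of_mem_layer (hε n) hx), fun hxy => by
      have := hlayer n x hx
      rw [mem_singleton_iff.1 hxy, sub_self, norm_zero] at this
      nlinarith⟩
  set φ := truncGreen w z with hφdef
  have hφ : ContDiff ℝ (⊤ : ℕ∞) φ := contDiff_truncGreen hw.contDiff z
  obtain ⟨L, -, hL⟩ := exists_bound_truncGreen hw.contDiff hz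
  obtain ⟨c, hc, hF⟩ := exists_bound_lap_ballCutoff_mul hφ hL
  have hηφ : ∀ n, ContDiff ℝ (⊤ : ℕ∞) fun x => ballCutoff (ε n) x * φ x := fun n =>
    (contDiff_ballCutoff _).mul hφ
  set F : ℕ → Euc d → ℝ := fun n x =>
    lap (fun x => ballCutoff (ε n) x * φ x) x - ballCutoff (ε n) x * lap φ x with hFdef
  have hFs : ∀ n, ContDiff ℝ (⊤ : ℕ∞) (F n) := fun n =>
    (hηφ n).lap.sub ((contDiff_ballCutoff _).mul hφ.lap)
  have hFc : ∀ n x, |F n x| ≤ c * shell (ε n) x := fun n x =>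
    hF (ε n) (hε n) (by linarith [hε' n, hε n]) x
  have hFsupp : ∀ n, Function.support (F n) ⊆ layer d (ε n) := fun n =>
    support_subset_layer_of_abs_le (hε n) (hFc n)
  have h_int : ∀ n (u : Euc d → ℝ), IsHarmonicOn u (ball (0 : Euc d) 1 \ {y}) →
      Integrable fun x => u x * F n x := fun n u hu =>
    integrable_mul_of_support_subset (isCompact_layer (hε n))
      (hu.1.continuousOn.mono (hlayerU n)) (hFs n).continuous (hFsupp n)
  have hlimk := hk.tendsto_of_abs_le (by omega) hharm.1.continuousOn hε hε' hlim hlayerU hc hFs hFc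
  have hlimG := tendsto_integral_greenBall_mul hd hy hε hε' hlim (τ := r ^ 2) (by positivity)
    (by gcongr; linarith) hlayer hc.le hFc
  have hlimh : Tendsto (fun n => ∫ x in ball (0 : Euc d) 1, h x * F n x) atTop (𝓝 0) := by
    have h0 := hlimk.sub (hlimG.const_mul b)
    rw [mul_zero, sub_zero] at h0
    refine h0.congr fun n => ?_
    rw [← integral_const_mul, ← integral_sub (h_int n k hharm).integrableOn
      ((h_int n G hGharm).integrableOn.const_mul b)]
    exact integral_congr_ae (Eventually.of_forall fun x => by simp only [hh, hG]; ring)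
  have hR : Integrable fun x => h x * radialLap d w (‖x - z‖ ^ 2) :=
    integrable_mul_of_support_subset (isCompact_closedBall z (Real.sqrt τ))
      (hhharm.1.continuousOn.mono hsub) (continuous_radialLap_norm_sub_sq hw.contDiff z)
      (support_radialLap_norm_sub_sq_subset hw z)
  have hident : ∀ n, ∫ x in ball (0 : Euc d) 1, h x * F n x =
      -∫ x, h x * radialLap d w (‖x - z‖ ^ 2) := by
    intro n
    have hts := tsupport_ballCutoff_mul_subset (hε n) φ
    have hball : {x : Euc d | ε n ≤ 1 - ‖x‖ ^ 2} ⊆ ball 0 1 := fun x hx => by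
      have h1 : ε n ≤ 1 - ‖x‖ ^ 2 := hx
      rw [mem_ball_zero_iff]
      nlinarith [norm_nonneg x, hε n]
    have hcs : HasCompactSupport fun x => ballCutoff (ε n) x * φ x :=
      (isCompact_closedBall (0 : Euc d) 1).of_isClosed_subset (isClosed_tsupport _)
        (hts.trans (hball.trans ball_subset_closedBall))
    have h0 := integral_mul_lap_eq_zero_of_bounded hd isOpen_ball hhharm
      (exists_bound_sub_greenBall hd hy hbdd) (hηφ n) hcs (hts.trans hball)
    have h1 : ∀ x, h x * lap (fun x => ballCutoff (ε n) x * φ x) x =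
        h x * F n x + h x * radialLap d w (‖x - z‖ ^ 2) := fun x => by
      rw [← ballCutoff_mul_lap_truncGreen hw hz hτ (hε n) (fun x hx => by
        linarith [heK x (Or.inl hx), hεe n, hε n]) x]
      simp only [hFdef]
      ring
    simp only [h1] at h0
    rw [integral_add (h_int n h hhharm) hR] at h0
    rw [setIntegral_eq_integral_of_forall_compl_eq_zero]
    · linarith
    · intro x hx
      rw [Function.notMem_support.1 fun hxs => hx (hlayerU n (hFsupp n hxs)).1, mul_zero]
  simp only [hident] at hlimh
  simpa using tendsto_nhds_unique tendsto_const_nhds hlimh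

/-- characterisation of the Green's function: a function harmonic off `y` with a
`b·s(|x-y|)` singularity at `y` and zero boundary values (in the averaged sense) is
`b·G^𝔹(·,y)`. -/
theorem statement9 (d : ℕ) (hd : 2 ≤ d) (y : Euc d) (hy : y ∈ ball (0 : Euc d) 1)
    (b : ℝ) (hb : 0 < b) (k : Euc d → ℝ)
    (hharm : IsHarmonicOn k (ball (0 : Euc d) 1 \ {y}))
    (hbdd : ∃ ε > 0, ∃ M : ℝ, ∀ x ∈ ball y ε \ {y}, |k x - b * sFun d ‖x - y‖| ≤ M)
    (hzero : ∀ f : ℕ → Euc d → ℝ, (∀ n, IsTestFun (f n)) → (∀ n x, 0 ≤ f n x) →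
      (∃ C : ℝ, ∀ n, ∫ x, f n x ≤ C) →
      Tendsto (fun n => Metric.infDist (0 : Euc d) (tsupport (f n))) atTop (𝓝 1) →
      (∃ C : ℝ, ∀ (n : ℕ) (x y' : Euc d), ‖x‖ = ‖y'‖ → ‖x‖ < 1 → f n x ≤ C * f n y') →
      Tendsto (fun n => ∫ x in ball (0 : Euc d) 1, k x * f n x) atTop (𝓝 0)) :
    ∀ x ∈ ball (0 : Euc d) 1, x ≠ y → k x = b * greenBall d x y := by
  intro z hz hzy
  rw [mem_ball_zero_iff] at hy
  have hz1 : ‖z‖ < 1 := mem_ball_zero_iff.1 hz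
  have hUo : IsOpen (ball (0 : Euc d) 1 \ {y}) := isOpen_ball.sdiff isClosed_singleton
  have hzU : ball (0 : Euc d) 1 \ {y} ∈ 𝓝 z := hUo.mem_nhds ⟨hz, hzy⟩
  set h : Euc d → ℝ := fun x => k x - b * greenBall d x y with hh
  have hhharm : IsHarmonicOn h (ball (0 : Euc d) 1 \ {y}) :=
    hharm.sub_const_mul hUo (isHarmonicOn_greenBall hd hy) b
  by_contra hne
  have hhz : h z ≠ 0 := sub_ne_zero.2 hne
  have hpos : ∀ᶠ x in 𝓝 z, 0 < h z * h x :=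
    (continuousAt_const.mul (hhharm.1.continuousOn.continuousAt hzU)).eventually
      (lt_mem_nhds (mul_self_pos.2 hhz))
  obtain ⟨ρ, hρ0, hρ⟩ := nhds_basis_closedBall.mem_iff.1 (inter_mem hzU hpos)
  set r := min ρ (1 - ‖z‖) with hr
  have hr0 : 0 < r := lt_min hρ0 (by linarith)
  have hsqrt : Real.sqrt (r ^ 2) = r := Real.sqrt_sq hr0.le
  have hball : closedBall z (Real.sqrt (r ^ 2)) ⊆ closedBall z ρ :=
    closedBall_subset_closedBall (hsqrt.le.trans (min_le_left _ _))
  obtain ⟨C, -, hw⟩ := exists_isTruncatedProfile hd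
  obtain ⟨w, hw⟩ := hw (r ^ 2) (by positivity)
  have hsub : closedBall z (Real.sqrt (r ^ 2)) ⊆ ball 0 1 \ {y} := fun x hx => (hρ (hball hx)).1
  have h0 := integral_sub_greenBall_mul_radialLap hd hy hharm hbdd hzero hz1 hw
    (by gcongr; exact min_le_right _ _) hsub
  have hcont := continuous_radialLap_norm_sub_sq hw.contDiff z
  have hsupp := support_radialLap_norm_sub_sq_subset hw z
  have h_int : Integrable fun x => -h z * (h x * radialLap d w (‖x - z‖ ^ 2)) :=
    (integrable_mul_of_support_subset (isCompact_closedBall z _)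
      (hhharm.1.continuousOn.mono hsub) hcont hsupp).const_mul _
  have hposx : ∀ x, radialLap d w (‖x - z‖ ^ 2) < 0 →
      0 < -h z * (h x * radialLap d w (‖x - z‖ ^ 2)) := fun x hx => by
    have h1 : 0 < h z * h x := (hρ (hball (hsupp hx.ne))).2
    nlinarith [mul_pos h1 (neg_pos.2 hx)]
  have hnn : 0 ≤ fun x => -h z * (h x * radialLap d w (‖x - z‖ ^ 2)) := fun x => by
    rcases (hw.radialLap_nonpos (‖x - z‖ ^ 2)).lt_or_eq with hx | hx
    · exact (hposx x hx).le
    · simp [hx]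
  have hopen : IsOpen {x : Euc d | radialLap d w (‖x - z‖ ^ 2) < 0} :=
    isOpen_lt hcont continuous_const
  have hnonempty : {x : Euc d | radialLap d w (‖x - z‖ ^ 2) < 0}.Nonempty := by
    obtain ⟨t, ht0, ht⟩ := hw.exists_radialLap_neg
    refine ⟨z + EuclideanSpace.single ⟨0, by omega⟩ (Real.sqrt t), ?_⟩
    rwa [mem_ofPred_eq, add_sub_cancel_left, PiLp.norm_single,
      Real.norm_of_nonneg (Real.sqrt_nonneg _), Real.sq_sqrt ht0.le]
  have hlt := (integral_pos_iff_support_of_nonneg hnn h_int).2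
    ((hopen.measure_pos volume hnonempty).trans_le (measure_mono fun x hx => (hposx x hx).ne'))
  rw [integral_const_mul, h0, mul_zero] at hlt
  exact lt_irrefl _ hlt
end
end
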